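/- arXiv:1212.6557 — 4 statements merged into one kernel-verified Lean document; each statement's English description precedes it below -/
import Mathlib

section
/- Let W and W' be k-subspaces of (R̄_c)^n, M = R̄^n/⟨W⟩ and M' = R̄^n/⟨W'⟩. Then M ≅ M' as graded R-modules if and only if there exists an automorphism σ of the graded R̄-module R̄^n (of degree zero) such that σ(W) = W'. -/
section Helpers

variable {k R : Type} [Field k] [CommRing R] [Algebra k R]

/-- The graded pieces of the ideal membership. -/
theorem aux_span (𝒜 : ℕ → Submodule k R) [GradedAlgebra 𝒜]
    (h0 : 𝒜 0 = (1 : Submodule k R)) (I : Ideal R) (n c : ℕ)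
    (W : Submodule k (Fin n → R ⧸ I))
    (hW : ∀ w ∈ W, ∀ j, ∃ x ∈ 𝒜 c, Ideal.Quotient.mk I x = w j)
    (v : Fin n → R ⧸ I) (hv : v ∈ Submodule.span R (W : Set (Fin n → R ⧸ I))) :
    ∃ x : Fin n → R, (∀ j, Ideal.Quotient.mk I (x j) = v j) ∧
      (∀ p < c, ∀ j, GradedRing.proj 𝒜 p (x j) = 0) ∧
      (fun j => Ideal.Quotient.mk I (GradedRing.proj 𝒜 c (x j))) ∈ W := by
  induction hv using Submodule.span_induction with
  | mem w hw =>
    choose x hx hxw using hW w hw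
    refine ⟨x, hxw, fun p hp j => ?_, ?_⟩
    · rw [GradedRing.proj_apply, DirectSum.decompose_of_mem_ne 𝒜 (hx j) (by omega)]
    · convert SetLike.mem_coe.mp hw using 1
      funext j
      rw [GradedRing.proj_apply, DirectSum.decompose_of_mem_same 𝒜 (hx j), hxw]
  | zero => exact ⟨0, by simp, by simp, by
      convert W.zero_mem using 1
      funext j
      simp⟩
  | add u v _ _ hu hv =>
    obtain ⟨x, h1, h2, h3⟩ := hu
    obtain ⟨z, h4, h5, h6⟩ := hv
    refine ⟨x + z, fun j => by simp [h1, h4], fun p hp j => by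
      simp only [Pi.add_apply, map_add, h2 p hp, h5 p hp, add_zero], ?_⟩
    convert W.add_mem h3 h6 using 1
    funext j
    simp
  | smul r v _ hv =>
    obtain ⟨x, h1, h2, h3⟩ := hv
    have hz : ∀ p, ∀ j, (∀ q < p, GradedRing.proj 𝒜 q (x j) = 0) →
        GradedRing.proj 𝒜 p (r * x j) = GradedRing.proj 𝒜 0 r * GradedRing.proj 𝒜 p (x j) := by
      intro p j hq
      simp only [GradedRing.proj_apply] at hq ⊢
      rw [DirectSum.decompose_mul, DirectSum.coe_mul_apply_eq_sum_antidiagonal,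
        Finset.sum_eq_single (0, p)]
      · rintro ⟨a, b⟩ hab hne
        have hab' : a + b = p := by simpa using hab
        have : b < p := by
          rcases Nat.eq_zero_or_pos a with h | h
          · exact absurd (by simp; omega) hne
          · omega
        simp [hq b this]
      · intro h
        simp at h
    refine ⟨fun j => r * x j, fun j => ?_, fun p hp j => ?_, ?_⟩
    · rw [map_mul, h1, Pi.smul_apply, Algebra.smul_def]; rfl
    · rw [hz p j (fun q hq => h2 q (hq.trans hp) j), h2 p hp, mul_zero]
    · have hr : GradedRing.proj 𝒜 0 r ∈ (1 : Submodule k R) := by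
        rw [← h0, GradedRing.proj_apply]
        exact SetLike.coe_mem _
      obtain ⟨a, ha⟩ := Submodule.mem_one.mp hr
      convert W.smul_mem a h3 using 1
      funext j
      rw [hz c j (fun q hq => h2 q hq j), ← ha, map_mul, Pi.smul_apply, Algebra.smul_def]
      rfl

theorem aux_proj (𝒜 : ℕ → Submodule k R) [GradedAlgebra 𝒜]
    (h0 : 𝒜 0 = (1 : Submodule k R)) (I : Ideal R) (hI : I.IsHomogeneous 𝒜) (n c : ℕ)
    (W : Submodule k (Fin n → R ⧸ I))
    (hW : ∀ w ∈ W, ∀ j, ∃ x ∈ 𝒜 c, Ideal.Quotient.mk I x = w j)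
    (v : Fin n → R ⧸ I) (hv : v ∈ Submodule.span R (W : Set (Fin n → R ⧸ I)))
    (p : ℕ) (hvp : ∀ j, ∃ x ∈ 𝒜 p, Ideal.Quotient.mk I x = v j) :
    (p < c → v = 0) ∧ (p = c → v ∈ W) := by
  obtain ⟨x, h1, h2, h3⟩ := aux_span 𝒜 h0 I n c W hW v hv
  choose z hz hzv using hvp
  have key : ∀ j, v j = Ideal.Quotient.mk I (GradedRing.proj 𝒜 p (x j)) := by
    intro j
    have hm : z j - x j ∈ I := by
      rw [← Ideal.Quotient.eq, hzv, h1]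
    have := hI p hm
    rw [DirectSum.decompose_sub, DirectSum.sub_apply, AddSubgroupClass.coe_sub,
      DirectSum.decompose_of_mem_same 𝒜 (hz j)] at this
    rw [← hzv, GradedRing.proj_apply]
    exact Ideal.Quotient.eq.mpr this
  refine ⟨fun hp => ?_, fun hp => ?_⟩
  · funext j
    rw [key, h2 p hp, map_zero]; rfl
  · subst hp
    convert h3 using 1
    funext j
    exact key j

theorem aux_ext (I : Ideal R) (n : ℕ) {M : Type} [AddCommGroup M] [Module R M]
    (f g : (Fin n → R ⧸ I) →ₗ[R] M)
    (h : ∀ i, f (Pi.single i 1) = g (Pi.single i 1)) : f = g := by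
  apply LinearMap.pi_ext
  intro i x
  obtain ⟨r, rfl⟩ := Ideal.Quotient.mk_surjective x
  have : (Pi.single i (Ideal.Quotient.mk I r) : Fin n → R ⧸ I) = r • Pi.single i 1 := by
    rw [← Pi.single_smul, Algebra.smul_def, mul_one]; rfl
  rw [this, map_smul, map_smul, h]

theorem aux_lift (I : Ideal R) (n : ℕ)
    (𝒜 : ℕ → Submodule k R) [GradedAlgebra 𝒜]
    (𝒢 : ℕ → Submodule k (Fin n → R ⧸ I))
    (h𝒢 : ∀ p v, v ∈ 𝒢 p ↔ ∀ j, ∃ x ∈ 𝒜 p, Ideal.Quotient.mk I x = v j)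
    (N N' : Submodule R (Fin n → R ⧸ I))
    (f : ((Fin n → R ⧸ I) ⧸ N) →ₗ[R] ((Fin n → R ⧸ I) ⧸ N'))
    (hf : ∀ v ∈ 𝒢 0, ∃ w ∈ 𝒢 0, N'.mkQ w = f (N.mkQ v)) :
    ∃ σ : (Fin n → R ⧸ I) →ₗ[R] (Fin n → R ⧸ I),
      (∀ p, ∀ v ∈ 𝒢 p, σ v ∈ 𝒢 p) ∧ ∀ v, N'.mkQ (σ v) = f (N.mkQ v) := by
  have hb : ∀ i, (Pi.single i 1 : Fin n → R ⧸ I) ∈ 𝒢 0 := by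
    intro i
    rw [h𝒢]
    intro j
    by_cases hij : j = i
    · subst hij
      exact ⟨1, SetLike.GradedOne.one_mem, by simp⟩
    · exact ⟨0, Submodule.zero_mem _, by simp [hij]⟩
  choose s hs hsf using fun i => hf _ (hb i)
  let σ : (Fin n → R ⧸ I) →ₗ[R] (Fin n → R ⧸ I) :=
    (Fintype.linearCombination (R ⧸ I) s).restrictScalars R
  have hσ : ∀ v, σ v = ∑ i, v i • s i := fun v => rfl
  refine ⟨σ, fun p v hv => ?_, fun v => ?_⟩
  · rw [hσ]
    refine Submodule.sum_mem _ fun i _ => ?_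
    rw [h𝒢]
    intro j
    obtain ⟨x, hx, hxv⟩ := (h𝒢 p v).mp hv i
    obtain ⟨z, hz, hzs⟩ := (h𝒢 0 _).mp (hs i) j
    refine ⟨x * z, by simpa using SetLike.mul_mem_graded hx hz, ?_⟩
    rw [map_mul, hxv, hzs]; rfl
  · have : N'.mkQ ∘ₗ σ = f ∘ₗ N.mkQ := by
      apply aux_ext
      intro i
      have : σ (Pi.single i 1) = s i := by
        rw [hσ, Finset.sum_eq_single i]
        · simp
        · intro j _ hj
          simp [hj]
        · simp
      rw [LinearMap.comp_apply, LinearMap.comp_apply, this, hsf]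
    exact LinearMap.congr_fun this v

end Helpers

/-- Let `W`, `W'` be `k`-subspaces of `(R̄_c)ⁿ`, `M = R̄ⁿ/⟨W⟩` and
`M' = R̄ⁿ/⟨W'⟩`.  Then `M ≅ M'` as graded `R`-modules iff there is a degree-zero
automorphism `σ` of the graded module `R̄ⁿ` with `σ(W) = W'`.
Here `R` is a standard graded Cohen–Macaulay algebra of Krull dimension `d` over an
infinite field `k`, `y = y₁,…,y_d` is an `R`-regular sequence of homogeneous elements of
degrees `mdeg i > 0`, `m = ∑ mdeg i`, `R̄ = R/(y)` and `c > m - d + 1`. -/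
theorem stmt_2
    (k R : Type) [Field k] [Infinite k] [CommRing R] [Algebra k R]
    (𝒜 : ℕ → Submodule k R) [GradedAlgebra 𝒜]
    (h0 : 𝒜 0 = (1 : Submodule k R))
    (hstd : Algebra.adjoin k ((𝒜 1 : Submodule k R) : Set R) = ⊤)
    (d : ℕ) (hdim : ringKrullDim R = d)
    (mdeg : Fin d → ℕ) (hmdeg : ∀ i, 0 < mdeg i)
    (y : Fin d → R) (hyhom : ∀ i, y i ∈ 𝒜 (mdeg i))
    (hyreg : RingTheory.Sequence.IsRegular R (List.ofFn y))
    (m : ℕ) (hm : m = ∑ i, mdeg i)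
    (c : ℕ) (hc : m - d + 1 < c)
    (n : ℕ) (hn : 0 < n) :
    -- `R̄ = R/(y)` with its induced grading, and the grading on `R̄ⁿ`
    ∀ (I : Ideal R), I = Ideal.span (Set.range y) →
    ∀ (𝒜bar : ℕ → Submodule k (R ⧸ I)),
      (∀ i, 𝒜bar i = (𝒜 i).map (Ideal.Quotient.mkₐ k I).toLinearMap) →
    ∀ (𝒢 : ℕ → Submodule k (Fin n → R ⧸ I)),
      (∀ p, 𝒢 p = Submodule.pi Set.univ fun _ => 𝒜bar p) →
    -- the subspaces `W, W' ⊆ (R̄_c)ⁿ`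
    ∀ (W W' : Submodule k (Fin n → R ⧸ I)), W ≤ 𝒢 c → W' ≤ 𝒢 c →
    -- `M = R̄ⁿ/⟨W⟩`, `M' = R̄ⁿ/⟨W'⟩` with their induced gradings `ℳ`, `ℳ'`
    ∀ (NW NW' : Submodule R (Fin n → R ⧸ I)),
      NW = Submodule.span R (W : Set (Fin n → R ⧸ I)) →
      NW' = Submodule.span R (W' : Set (Fin n → R ⧸ I)) →
    ∀ (ℳ : ℕ → Submodule k ((Fin n → R ⧸ I) ⧸ NW)),
      (∀ p, ℳ p = (𝒢 p).map (NW.mkQ.restrictScalars k)) →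
    ∀ (ℳ' : ℕ → Submodule k ((Fin n → R ⧸ I) ⧸ NW')),
      (∀ p, ℳ' p = (𝒢 p).map (NW'.mkQ.restrictScalars k)) →
    -- `M ≅ M'` as graded `R`-modules ↔ ∃ degree-zero automorphism `σ` of `R̄ⁿ` with `σ(W) = W'`
    ((∃ e : ((Fin n → R ⧸ I) ⧸ NW) ≃ₗ[R] ((Fin n → R ⧸ I) ⧸ NW'),
        ∀ p, (ℳ p).map (e.toLinearMap.restrictScalars k) = ℳ' p)
      ↔ (∃ σ : (Fin n → R ⧸ I) ≃ₗ[R] (Fin n → R ⧸ I),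
          (∀ p, (𝒢 p).map (σ.toLinearMap.restrictScalars k) = 𝒢 p) ∧
          W.map (σ.toLinearMap.restrictScalars k) = W')) := by
  intro I hI 𝒜bar h𝒜bar 𝒢 h𝒢' W W' hW hW' NW NW' hNW hNW' ℳ hℳ ℳ' hℳ'
  have hIhom : I.IsHomogeneous 𝒜 := by
    rw [hI]
    apply Ideal.homogeneous_span
    rintro _ ⟨i, rfl⟩
    exact ⟨_, hyhom i⟩
  have h𝒢 : ∀ p v, v ∈ 𝒢 p ↔ ∀ j, ∃ x ∈ 𝒜 p, Ideal.Quotient.mk I x = v j := by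
    intro p v
    rw [h𝒢', Submodule.mem_pi]
    simp only [Set.mem_univ, true_imp_iff, h𝒜bar, Submodule.mem_map]
    rfl
  have hWl : ∀ w ∈ W, ∀ j, ∃ x ∈ 𝒜 c, Ideal.Quotient.mk I x = w j :=
    fun w hw => (h𝒢 c w).mp (hW hw)
  have hWl' : ∀ w ∈ W', ∀ j, ∃ x ∈ 𝒜 c, Ideal.Quotient.mk I x = w j :=
    fun w hw => (h𝒢 c w).mp (hW' hw)
  have hc0 : 0 < c := by omega
  constructor
  · rintro ⟨e, he⟩
    have hf : ∀ v ∈ 𝒢 0, ∃ w ∈ 𝒢 0, NW'.mkQ w = e.toLinearMap (NW.mkQ v) := by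
      intro v hv
      have h1 : e (NW.mkQ v) ∈ ℳ' 0 := by
        rw [← he 0, hℳ]
        exact ⟨_, ⟨v, hv, rfl⟩, rfl⟩
      rw [hℳ'] at h1
      exact h1
    have hf' : ∀ v ∈ 𝒢 0, ∃ w ∈ 𝒢 0, NW.mkQ w = e.symm.toLinearMap (NW'.mkQ v) := by
      intro v hv
      have h1 : NW'.mkQ v ∈ ℳ' 0 := by
        rw [hℳ']
        exact ⟨v, hv, rfl⟩
      rw [← he 0, hℳ] at h1
      obtain ⟨_, ⟨w, hw, rfl⟩, h2⟩ := h1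
      refine ⟨w, hw, ?_⟩
      rw [← h2]
      exact (e.symm_apply_apply _).symm
    obtain ⟨σ, hσ, hσe⟩ := aux_lift I n 𝒜 𝒢 h𝒢 NW NW' _ hf
    obtain ⟨τ, hτ, hτe⟩ := aux_lift I n 𝒜 𝒢 h𝒢 NW' NW _ hf'
    have hb : ∀ i, (Pi.single i 1 : Fin n → R ⧸ I) ∈ 𝒢 0 := by
      intro i
      rw [h𝒢]
      intro j
      by_cases hij : j = i
      · subst hij
        exact ⟨1, SetLike.GradedOne.one_mem, by simp⟩
      · exact ⟨0, Submodule.zero_mem _, by simp [hij]⟩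
    have hτσ : τ ∘ₗ σ = LinearMap.id := by
      apply aux_ext
      intro i
      rw [LinearMap.comp_apply, LinearMap.id_apply, ← sub_eq_zero]
      refine (aux_proj 𝒜 h0 I hIhom n c W hWl _ ?_ 0 ((h𝒢 0 _).mp
        (Submodule.sub_mem _ (hτ 0 _ (hσ 0 _ (hb i))) (hb i)))).1 hc0
      rw [← hNW, ← Submodule.Quotient.mk_eq_zero, ← Submodule.mkQ_apply, map_sub, hτe, hσe]
      simp
    have hστ : σ ∘ₗ τ = LinearMap.id := by
      apply aux_ext
      intro i
      rw [LinearMap.comp_apply, LinearMap.id_apply, ← sub_eq_zero]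
      refine (aux_proj 𝒜 h0 I hIhom n c W' hWl' _ ?_ 0 ((h𝒢 0 _).mp
        (Submodule.sub_mem _ (hσ 0 _ (hτ 0 _ (hb i))) (hb i)))).1 hc0
      rw [← hNW', ← Submodule.Quotient.mk_eq_zero, ← Submodule.mkQ_apply, map_sub, hσe, hτe]
      simp
    have hσW : ∀ w ∈ W, σ w ∈ W' := by
      intro w hw
      refine (aux_proj 𝒜 h0 I hIhom n c W' hWl' _ ?_ c ((h𝒢 c _).mp
        (hσ c _ (hW hw)))).2 rfl
      have hw0 : NW.mkQ w = 0 := by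
        rw [Submodule.mkQ_apply, Submodule.Quotient.mk_eq_zero, hNW]
        exact Submodule.subset_span hw
      rw [← hNW', ← Submodule.Quotient.mk_eq_zero, ← Submodule.mkQ_apply, hσe, hw0, map_zero]
    have hτW : ∀ w ∈ W', τ w ∈ W := by
      intro w hw
      refine (aux_proj 𝒜 h0 I hIhom n c W hWl _ ?_ c ((h𝒢 c _).mp
        (hτ c _ (hW' hw)))).2 rfl
      have hw0 : NW'.mkQ w = 0 := by
        rw [Submodule.mkQ_apply, Submodule.Quotient.mk_eq_zero, hNW']
        exact Submodule.subset_span hw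
      rw [← hNW, ← Submodule.Quotient.mk_eq_zero, ← Submodule.mkQ_apply, hτe, hw0, map_zero]
    refine ⟨LinearEquiv.ofLinearMap σ τ hστ hτσ, fun p => le_antisymm ?_ ?_, le_antisymm ?_ ?_⟩
    · rintro _ ⟨v, hv, rfl⟩
      exact hσ p v hv
    · intro v hv
      exact ⟨τ v, hτ p v hv, LinearMap.congr_fun hστ v⟩
    · rintro _ ⟨v, hv, rfl⟩
      exact hσW v hv
    · intro v hv
      exact ⟨τ v, hτW v hv, LinearMap.congr_fun hστ v⟩
  · rintro ⟨σ, hσ, hσW⟩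
    have hN : NW.map σ.toLinearMap = NW' := by
      rw [hNW, hNW', Submodule.map_span, ← hσW]
      rfl
    refine ⟨Submodule.Quotient.equiv NW NW' σ hN, fun p => ?_⟩
    rw [hℳ, hℳ']
    conv_rhs => rw [← hσ p]
    rw [← Submodule.map_comp, ← Submodule.map_comp]
    rfl
end

section
/- Suppose e_1, e_2, e_3 ∈ R̄_c are linearly independent over k, where c > m − d + 1. For a pair A = (A_x, A_y) of n×n matrices over k, let W(A) ⊆ (R̄_c)^n be the k-subspace spanned by the columns of the n×n matrix I·e_1 + A_x·e_2 + A_y·e_3 with entries in R̄_c (I the identity matrix), and set M_A = R̄^n/⟨W(A)⟩. Then for pairs A = (A_x, A_y) and B = (B_x, B_y) of n×n matrices, M_A ≅ M_B as graded R-modules if and only if there exists σ ∈ GL_n(k) with B_x = σA_xσ^{-1} and B_y = σA_yσ^{-1}. -/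
namespace Stmt9

/-- The `R`-linear endomorphism of `Qⁿ` given by a matrix over `k`. -/
noncomputable def L {k R Q : Type} [Field k] [CommRing R] [AddCommGroup Q] [Module k Q] [Module R Q]
    [SMulCommClass R k Q] {n : ℕ} (S : Matrix (Fin n) (Fin n) k) :
    (Fin n → Q) →ₗ[R] (Fin n → Q) :=
  LinearMap.pi fun i => ∑ j, S i j • LinearMap.proj j

section
variable {k R Q : Type} [Field k] [CommRing R] [AddCommGroup Q] [Module k Q] [Module R Q]
    [SMulCommClass R k Q] {n : ℕ}

lemma L_apply (S : Matrix (Fin n) (Fin n) k) (x : Fin n → Q) (i : Fin n) :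
    L (R := R) S x i = ∑ j, S i j • x j := by
  simp [L]

lemma L_mul (S T : Matrix (Fin n) (Fin n) k) (x : Fin n → Q) :
    L (R := R) S (L (R := R) T x) = L (R := R) (S * T) x := by
  ext i
  simp only [L_apply, Matrix.mul_apply, Finset.smul_sum, Finset.sum_smul, mul_smul]
  rw [Finset.sum_comm]

lemma L_one (x : Fin n → Q) : L (R := R) (1 : Matrix (Fin n) (Fin n) k) x = x := by
  ext i
  simp [L_apply, Matrix.one_apply, ite_smul]

/-- The matrix `I e₁ + Ax e₂ + Ay e₃` multiplied by `S` on the left. -/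
lemma L_col (S Ax Ay : Matrix (Fin n) (Fin n) k) (e₁ e₂ e₃ : Q) (colA : Fin n → (Fin n → Q))
    (hA : ∀ j i, colA j i = (if i = j then e₁ else 0) + Ax i j • e₂ + Ay i j • e₃) (j i : Fin n) :
    L (R := R) S (colA j) i = S i j • e₁ + (S * Ax) i j • e₂ + (S * Ay) i j • e₃ := by
  simp only [L_apply, hA, smul_add, Finset.sum_add_distrib, Matrix.mul_apply, Finset.sum_smul,
    mul_smul, smul_ite, smul_zero]
  simp

/-- The matrix `I e₁ + Bx e₂ + By e₃` multiplied by `S` on the right. -/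
lemma col_sum (S Bx By : Matrix (Fin n) (Fin n) k) (e₁ e₂ e₃ : Q) (colB : Fin n → (Fin n → Q))
    (hB : ∀ j i, colB j i = (if i = j then e₁ else 0) + Bx i j • e₂ + By i j • e₃) (j i : Fin n) :
    ∑ l, S l j • colB l i = S i j • e₁ + (Bx * S) i j • e₂ + (By * S) i j • e₃ := by
  simp only [hB, smul_add, Finset.sum_add_distrib, Matrix.mul_apply, Finset.sum_smul,
    smul_ite, smul_zero, smul_smul]
  simp [mul_comm]

lemma ker_le [Algebra k R] [IsScalarTower k R Q] (S Ax Ay Bx By : Matrix (Fin n) (Fin n) k)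
    (e₁ e₂ e₃ : Q)
    (colA colB : Fin n → (Fin n → Q))
    (hA : ∀ j i, colA j i = (if i = j then e₁ else 0) + Ax i j • e₂ + Ay i j • e₃)
    (hB : ∀ j i, colB j i = (if i = j then e₁ else 0) + Bx i j • e₂ + By i j • e₃)
    (hx : S * Ax = Bx * S) (hy : S * Ay = By * S) :
    (Submodule.span R (Set.range colA)).map (L (R := R) S) ≤ Submodule.span R (Set.range colB) := by
  rw [Submodule.map_span_le]
  rintro _ ⟨j, rfl⟩
  have : L (R := R) S (colA j) = ∑ l, S l j • colB l := by
    ext i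
    rw [L_col S Ax Ay e₁ e₂ e₃ colA hA, hx, hy, ← col_sum S Bx By e₁ e₂ e₃ colB hB]
    simp
  rw [this]
  refine Submodule.sum_mem _ fun l _ => ?_
  exact Submodule.smul_of_tower_mem _ _ (Submodule.subset_span ⟨l, rfl⟩)

lemma L_mem (S : Matrix (Fin n) (Fin n) k) (P : Submodule k Q) (x : Fin n → Q)
    (hx : x ∈ Submodule.pi Set.univ fun _ : Fin n => P) :
    L (R := R) S x ∈ Submodule.pi Set.univ fun _ : Fin n => P := by
  simp only [Submodule.mem_pi, Set.mem_univ, true_imp_iff] at hx ⊢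
  intro i
  rw [L_apply]
  exact Submodule.sum_mem _ fun j _ => P.smul_mem _ (hx j)

end

/-- Projection to a graded component on the quotient by a homogeneous ideal. -/
lemma exists_proj {k R : Type} [Field k] [CommRing R] [Algebra k R]
    (𝒜 : ℕ → Submodule k R) [GradedAlgebra 𝒜] (I : Ideal R) (hI : I.IsHomogeneous 𝒜) (p : ℕ) :
    ∃ π : (R ⧸ I) →+ (R ⧸ I), ∀ r, π (Ideal.Quotient.mk I r)
      = Ideal.Quotient.mk I (DirectSum.decompose 𝒜 r p : R) := by
  refine ⟨QuotientAddGroup.map _ _ (GradedRing.proj 𝒜 p) ?_, fun r => rfl⟩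
  intro r hr
  exact hI p hr

lemma forward_mat {k R : Type} [Field k] [CommRing R] [Algebra k R]
    (I : Ideal R) {n : ℕ} (G0 : Submodule k (Fin n → R ⧸ I))
    (hG0 : ∀ v ∈ G0, ∀ i, ∃ t : k, v i = algebraMap k (R ⧸ I) t)
    (hG1 : ∀ j, Pi.single j 1 ∈ G0)
    (NA NB : Submodule R (Fin n → R ⧸ I))
    (e : ((Fin n → R ⧸ I) ⧸ NA) →ₗ[R] ((Fin n → R ⧸ I) ⧸ NB))
    (he : (G0.map (NA.mkQ.restrictScalars k)).map (e.restrictScalars k)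
      ≤ G0.map (NB.mkQ.restrictScalars k)) :
    ∃ S : Matrix (Fin n) (Fin n) k, ∀ x, e (NA.mkQ x) = NB.mkQ (L (R := R) S x) := by
  have h1 : ∀ j : Fin n, ∃ s : Fin n → k,
      e (NA.mkQ (Pi.single j 1)) = NB.mkQ (fun i => algebraMap k (R ⧸ I) (s i)) := by
    intro j
    obtain ⟨v, hv, hve⟩ := he (Submodule.mem_map_of_mem (Submodule.mem_map_of_mem (hG1 j)))
    choose s hs using hG0 v hv
    refine ⟨s, ?_⟩
    rw [← funext hs]
    exact hve.symm
  choose s hs using h1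
  refine ⟨Matrix.of fun i j => s j i, fun x => ?_⟩
  have : e ∘ₗ NA.mkQ = NB.mkQ ∘ₗ L (R := R) (Matrix.of fun i j => s j i) := by
    refine LinearMap.pi_ext' fun j => ?_
    refine Submodule.linearMap_qext _ ?_
    refine LinearMap.ext_ring ?_
    refine (hs j).trans ?_
    change _ = NB.mkQ (L (R := R) _ (Pi.single j 1))
    congr 1
    ext i
    rw [L_apply]
    simp [Pi.single_apply, Algebra.algebraMap_eq_smul_one]
  exact LinearMap.congr_fun this x

end Stmt9

/-- Suppose `e₁, e₂, e₃ ∈ R̄_c` are linearly independent over `k`, where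
`c > m - d + 1`.  For a pair `A = (Ax, Ay)` of `n×n` matrices over `k`, let
`W(A) ⊆ (R̄_c)ⁿ` be the `k`-subspace spanned by the columns of `I·e₁ + Ax·e₂ + Ay·e₃`
and `M_A = R̄ⁿ/⟨W(A)⟩`.  Then `M_A ≅ M_B` as graded `R`-modules iff there is
`σ ∈ GLₙ(k)` with `Bx = σ Ax σ⁻¹` and `By = σ Ay σ⁻¹`.
Here `R` is a standard graded Cohen–Macaulay algebra of Krull dimension `d` over an
infinite field `k`, `y` is an `R`-regular sequence of homogeneous elements of degrees
`mdeg i > 0`, `m = ∑ mdeg i` and `R̄ = R/(y)`. -/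
theorem stmt_9
    (k R : Type) [Field k] [Infinite k] [CommRing R] [Algebra k R]
    (𝒜 : ℕ → Submodule k R) [GradedAlgebra 𝒜]
    (h0 : 𝒜 0 = (1 : Submodule k R))
    (hstd : Algebra.adjoin k ((𝒜 1 : Submodule k R) : Set R) = ⊤)
    (d : ℕ) (hdim : ringKrullDim R = d)
    (mdeg : Fin d → ℕ) (hmdeg : ∀ i, 0 < mdeg i)
    (y : Fin d → R) (hyhom : ∀ i, y i ∈ 𝒜 (mdeg i))
    (hyreg : RingTheory.Sequence.IsRegular R (List.ofFn y))
    (m : ℕ) (hm : m = ∑ i, mdeg i)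
    (c : ℕ) (hc : m - d + 1 < c)
    (n : ℕ) (hn : 0 < n) :
    -- `R̄ = R/(y)` with its induced grading, and the grading on `R̄ⁿ`
    ∀ (I : Ideal R), I = Ideal.span (Set.range y) →
    ∀ (𝒜bar : ℕ → Submodule k (R ⧸ I)),
      (∀ i, 𝒜bar i = (𝒜 i).map (Ideal.Quotient.mkₐ k I).toLinearMap) →
    ∀ (𝒢 : ℕ → Submodule k (Fin n → R ⧸ I)),
      (∀ p, 𝒢 p = Submodule.pi Set.univ fun _ => 𝒜bar p) →
    -- `e₁, e₂, e₃ ∈ R̄_c` linearly independent over `k`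
    ∀ (e₁ e₂ e₃ : R ⧸ I), e₁ ∈ 𝒜bar c → e₂ ∈ 𝒜bar c → e₃ ∈ 𝒜bar c →
      LinearIndependent k ![e₁, e₂, e₃] →
    -- the matrix pairs and the columns of `I·e₁ + Ax·e₂ + Ay·e₃`
    ∀ (Ax Ay Bx By : Matrix (Fin n) (Fin n) k),
    ∀ (colA colB : Fin n → (Fin n → R ⧸ I)),
      (∀ j i, colA j i = (if i = j then e₁ else 0) + Ax i j • e₂ + Ay i j • e₃) →
      (∀ j i, colB j i = (if i = j then e₁ else 0) + Bx i j • e₂ + By i j • e₃) →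
    -- `W(A)`, `W(B)` and `M_A = R̄ⁿ/⟨W(A)⟩`, `M_B = R̄ⁿ/⟨W(B)⟩` with induced gradings
    ∀ (NA NB : Submodule R (Fin n → R ⧸ I)),
      NA = Submodule.span R (Set.range colA) →
      NB = Submodule.span R (Set.range colB) →
    ∀ (ℳA : ℕ → Submodule k ((Fin n → R ⧸ I) ⧸ NA)),
      (∀ p, ℳA p = (𝒢 p).map (NA.mkQ.restrictScalars k)) →
    ∀ (ℳB : ℕ → Submodule k ((Fin n → R ⧸ I) ⧸ NB)),
      (∀ p, ℳB p = (𝒢 p).map (NB.mkQ.restrictScalars k)) →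
    -- `M_A ≅ M_B` as graded `R`-modules ↔ the pairs of matrices are simultaneously conjugate
    ((∃ e : ((Fin n → R ⧸ I) ⧸ NA) ≃ₗ[R] ((Fin n → R ⧸ I) ⧸ NB),
        ∀ p, (ℳA p).map (e.toLinearMap.restrictScalars k) = ℳB p)
      ↔ (∃ σ : GL (Fin n) k,
          Bx = (σ : Matrix (Fin n) (Fin n) k) * Ax * ((σ⁻¹ : GL (Fin n) k) : Matrix (Fin n) (Fin n) k) ∧
          By = (σ : Matrix (Fin n) (Fin n) k) * Ay * ((σ⁻¹ : GL (Fin n) k) : Matrix (Fin n) (Fin n) k))) := by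
  intro I hI 𝒜bar h𝒜bar 𝒢 h𝒢 e₁ e₂ e₃ he₁ he₂ he₃ hli Ax Ay Bx By colA colB hA hB NA NB hNA hNB
    ℳA hℳA ℳB hℳB
  have hIhom : I.IsHomogeneous 𝒜 := by
    rw [hI]
    refine Ideal.homogeneous_span 𝒜 _ ?_
    rintro _ ⟨i, rfl⟩
    exact ⟨mdeg i, hyhom i⟩
  have hcpos : 0 < c := by omega
  have hnt : Nontrivial (R ⧸ I) := ⟨e₁, 0, hli.ne_zero 0⟩
  have h0' : ∀ a ∈ 𝒜 0, ∃ t : k, a = algebraMap k R t := by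
    intro a ha
    rw [h0, Submodule.mem_one] at ha
    obtain ⟨t, rfl⟩ := ha
    exact ⟨t, rfl⟩
  have hcolmem : ∀ (Cx Cy : Matrix (Fin n) (Fin n) k) (col : Fin n → (Fin n → R ⧸ I)),
      (∀ j i, col j i = (if i = j then e₁ else 0) + Cx i j • e₂ + Cy i j • e₃) →
      ∀ j i, col j i ∈ 𝒜bar c := by
    intro Cx Cy col hC j i
    rw [hC]
    refine add_mem (add_mem ?_ (Submodule.smul_mem _ _ he₂)) (Submodule.smul_mem _ _ he₃)
    split_ifs
    exacts [he₁, zero_mem _]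
  obtain ⟨π0, hπ0⟩ := Stmt9.exists_proj 𝒜 I hIhom 0
  obtain ⟨πc, hπc⟩ := Stmt9.exists_proj 𝒜 I hIhom c
  have hπ0mul : ∀ (r : R), ∀ x ∈ 𝒜bar c, π0 (r • x) = 0 := by
    intro r x hx
    rw [h𝒜bar] at hx
    obtain ⟨a, ha, rfl⟩ := hx
    change π0 (Ideal.Quotient.mk I (r * a)) = 0
    rw [hπ0, DirectSum.coe_decompose_mul_of_right_mem_of_not_le 𝒜 ha (by omega), map_zero]
  have hπcmul : ∀ (r : R), ∃ t : k, ∀ x ∈ 𝒜bar c, πc (r • x) = t • x := by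
    intro r
    obtain ⟨t, ht⟩ := h0' _ (DirectSum.decompose 𝒜 r 0).2
    refine ⟨t, fun x hx => ?_⟩
    rw [h𝒜bar] at hx
    obtain ⟨a, ha, rfl⟩ := hx
    change πc (Ideal.Quotient.mk I (r * a)) = t • (Ideal.Quotient.mkₐ k I) a
    rw [hπc, DirectSum.coe_decompose_mul_of_right_mem_of_le 𝒜 ha le_rfl, Nat.sub_self, ht,
      ← map_smul, Algebra.smul_def]
    rfl
  have hπcid : ∀ x ∈ 𝒜bar c, πc x = x := by
    intro x hx
    rw [h𝒜bar] at hx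
    obtain ⟨a, ha, rfl⟩ := hx
    change πc (Ideal.Quotient.mk I a) = Ideal.Quotient.mk I a
    rw [hπc, DirectSum.decompose_of_mem_same 𝒜 ha]
  have hπ0alg : ∀ t : k, π0 (algebraMap k (R ⧸ I) t) = algebraMap k (R ⧸ I) t := by
    intro t
    change π0 (Ideal.Quotient.mk I (algebraMap k R t)) = Ideal.Quotient.mk I (algebraMap k R t)
    rw [hπ0, DirectSum.decompose_of_mem_same 𝒜]
    rw [h0, Submodule.mem_one]
    exact ⟨t, rfl⟩
  have hN0 : ∀ col : Fin n → (Fin n → R ⧸ I), (∀ j i, col j i ∈ 𝒜bar c) →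
      ∀ x ∈ Submodule.span R (Set.range col), ∀ i, π0 (x i) = 0 := by
    intro col hcol x hx i
    obtain ⟨a, rfl⟩ := (Submodule.mem_span_range_iff_exists_fun R).1 hx
    simp only [Finset.sum_apply, Pi.smul_apply, map_sum]
    exact Finset.sum_eq_zero fun j _ => hπ0mul _ _ (hcol j i)
  have hNc : ∀ col : Fin n → (Fin n → R ⧸ I), (∀ j i, col j i ∈ 𝒜bar c) →
      ∀ x ∈ Submodule.span R (Set.range col), ∃ t : Fin n → k,
        ∀ i, πc (x i) = ∑ l, t l • col l i := by
    intro col hcol x hx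
    obtain ⟨a, rfl⟩ := (Submodule.mem_span_range_iff_exists_fun R).1 hx
    choose t ht using hπcmul
    refine ⟨fun l => t (a l), fun i => ?_⟩
    simp only [Finset.sum_apply, Pi.smul_apply, map_sum]
    exact Finset.sum_congr rfl fun j _ => ht _ _ (hcol j i)
  have hli' : ∀ a b c' a' b' c'' : k,
      a • e₁ + b • e₂ + c' • e₃ = a' • e₁ + b' • e₂ + c'' • e₃ → a = a' ∧ b = b' ∧ c' = c'' := by
    intro a b c' a' b' c'' h
    have := Fintype.linearIndependent_iff.1 hli ![a - a', b - b', c' - c''] (by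
      simp only [Fin.sum_univ_three, Matrix.cons_val_zero, Matrix.cons_val_one, Matrix.cons_val,
        sub_smul]
      rw [← sub_eq_zero] at h
      rw [← h]
      abel)
    exact ⟨sub_eq_zero.1 (this 0), sub_eq_zero.1 (this 1), sub_eq_zero.1 (this 2)⟩
  have hG0 : ∀ v ∈ 𝒢 0, ∀ i, ∃ t : k, v i = algebraMap k (R ⧸ I) t := by
    intro v hv i
    rw [h𝒢] at hv
    have := hv i (Set.mem_univ _)
    rw [h𝒜bar] at this
    obtain ⟨a, ha, hav⟩ := this
    obtain ⟨t, rfl⟩ := h0' a ha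
    exact ⟨t, hav.symm⟩
  have hG1 : ∀ j, Pi.single j 1 ∈ 𝒢 0 := by
    intro j
    rw [h𝒢]
    intro i _
    rw [Pi.single_apply]
    split_ifs
    · rw [h𝒜bar]
      exact ⟨1, SetLike.GradedOne.one_mem, map_one (Ideal.Quotient.mkₐ k I)⟩
    · exact zero_mem _
  constructor
  · rintro ⟨e, he⟩
    obtain ⟨S, hS⟩ := Stmt9.forward_mat (k := k) I (𝒢 0) hG0 hG1 NA NB e.toLinearMap (by
      rw [← hℳA, ← hℳB, he])
    obtain ⟨T, hT⟩ := Stmt9.forward_mat (k := k) I (𝒢 0) hG0 hG1 NB NA e.symm.toLinearMap (by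
      rw [← hℳA, ← hℳB, ← he]
      rintro _ ⟨_, ⟨x, hx, rfl⟩, rfl⟩
      simpa using hx)
    have hTS : T * S = 1 := by
      ext i j
      have h1 : NA.mkQ (Stmt9.L (R := R) (T * S) (Pi.single j 1)) = NA.mkQ (Pi.single j 1) := by
        rw [← Stmt9.L_mul, ← hT, ← hS]
        simp
      have h2 : Stmt9.L (R := R) (T * S) (Pi.single j 1) - Pi.single j (1 : R ⧸ I) ∈ NA :=
        (Submodule.Quotient.eq NA).1 h1
      rw [hNA] at h2
      have h3 := hN0 colA (hcolmem Ax Ay colA hA) _ h2 i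
      have h4 : (Stmt9.L (R := R) (T * S) (Pi.single j 1) - Pi.single j (1 : R ⧸ I) : Fin n → R ⧸ I) i
          = algebraMap k (R ⧸ I) ((T * S) i j - (1 : Matrix (Fin n) (Fin n) k) i j) := by
        rw [Pi.sub_apply, Stmt9.L_apply]
        simp [Pi.single_apply, Algebra.algebraMap_eq_smul_one, Matrix.one_apply, sub_smul, ite_smul]
      rw [h4, hπ0alg] at h3
      exact sub_eq_zero.1 ((map_eq_zero _).1 h3)
    have hST : S * T = 1 := mul_eq_one_comm.1 hTS
    have key : ∀ j, ∃ t : Fin n → k, ∀ i, Stmt9.L (R := R) S (colA j) i = ∑ l, t l • colB l i := by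
      intro j
      have h1 : Stmt9.L (R := R) S (colA j) ∈ NB := by
        rw [← Submodule.Quotient.mk_eq_zero]
        change NB.mkQ _ = 0
        rw [← hS]
        have : NA.mkQ (colA j) = 0 := by
          rw [Submodule.mkQ_apply, Submodule.Quotient.mk_eq_zero, hNA]
          exact Submodule.subset_span ⟨j, rfl⟩
        rw [this, map_zero]
      rw [hNB] at h1
      obtain ⟨t, ht⟩ := hNc colB (hcolmem Bx By colB hB) _ h1
      refine ⟨t, fun i => ?_⟩
      rw [← ht, hπcid]
      exact Stmt9.L_mem S (𝒜bar c) (colA j) (fun i _ => hcolmem Ax Ay colA hA j i) i (Set.mem_univ _)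
    choose t ht using key
    let U : Matrix (Fin n) (Fin n) k := fun l j => t j l
    have hU : ∀ i j, S i j = U i j ∧ (S * Ax) i j = (Bx * U) i j ∧ (S * Ay) i j = (By * U) i j := by
      intro i j
      apply hli'
      rw [← Stmt9.L_col (R := R) S Ax Ay e₁ e₂ e₃ colA hA, ← Stmt9.col_sum U Bx By e₁ e₂ e₃ colB hB]
      exact ht j i
    have hSU : S = U := by ext i j; exact (hU i j).1
    have hx : S * Ax = Bx * S := by ext i j; rw [(hU i j).2.1, ← hSU]
    have hy : S * Ay = By * S := by ext i j; rw [(hU i j).2.2, ← hSU]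
    refine ⟨⟨S, T, hST, hTS⟩, ?_, ?_⟩
    · change Bx = S * Ax * T
      rw [hx, mul_assoc, hST, mul_one]
    · change By = S * Ay * T
      rw [hy, mul_assoc, hST, mul_one]
  · rintro ⟨σ, hx, hy⟩
    have hx1 : (σ : Matrix (Fin n) (Fin n) k) * Ax = Bx * σ := by
      rw [hx, mul_assoc, Units.inv_mul, mul_one]
    have hy1 : (σ : Matrix (Fin n) (Fin n) k) * Ay = By * σ := by
      rw [hy, mul_assoc, Units.inv_mul, mul_one]
    have hx2 : ((σ⁻¹ : GL (Fin n) k) : Matrix (Fin n) (Fin n) k) * Bx = Ax * (σ⁻¹ : GL (Fin n) k) := by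
      rw [hx, ← mul_assoc, ← mul_assoc, Units.inv_mul, one_mul]
    have hy2 : ((σ⁻¹ : GL (Fin n) k) : Matrix (Fin n) (Fin n) k) * By = Ay * (σ⁻¹ : GL (Fin n) k) := by
      rw [hy, ← mul_assoc, ← mul_assoc, Units.inv_mul, one_mul]
    have i1 : ∀ x : Fin n → R ⧸ I, Stmt9.L (R := R) (σ : Matrix (Fin n) (Fin n) k)
        (Stmt9.L (R := R) ((σ⁻¹ : GL (Fin n) k) : Matrix (Fin n) (Fin n) k) x) = x := by
      intro x; rw [Stmt9.L_mul, Units.mul_inv, Stmt9.L_one]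
    have i2 : ∀ x : Fin n → R ⧸ I, Stmt9.L (R := R) ((σ⁻¹ : GL (Fin n) k) : Matrix (Fin n) (Fin n) k)
        (Stmt9.L (R := R) (σ : Matrix (Fin n) (Fin n) k) x) = x := by
      intro x; rw [Stmt9.L_mul, Units.inv_mul, Stmt9.L_one]
    let f : (Fin n → R ⧸ I) ≃ₗ[R] (Fin n → R ⧸ I) := LinearEquiv.ofLinearMap
      (Stmt9.L (R := R) (σ : Matrix (Fin n) (Fin n) k))
      (Stmt9.L (R := R) ((σ⁻¹ : GL (Fin n) k) : Matrix (Fin n) (Fin n) k))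
      (LinearMap.ext i1) (LinearMap.ext i2)
    have hf : NA.map f.toLinearMap = NB := by
      apply le_antisymm
      · rw [hNA, hNB]
        exact Stmt9.ker_le _ Ax Ay Bx By e₁ e₂ e₃ colA colB hA hB hx1 hy1
      · intro x hxm
        refine ⟨Stmt9.L (R := R) ((σ⁻¹ : GL (Fin n) k) : Matrix (Fin n) (Fin n) k) x, ?_, i1 x⟩
        have := Stmt9.ker_le (R := R) _ Bx By Ax Ay e₁ e₂ e₃ colB colA hB hA hx2 hy2
        rw [hNA]
        rw [hNB] at hxm
        exact this (Submodule.mem_map_of_mem hxm)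
    refine ⟨Submodule.Quotient.equiv NA NB f hf, fun p => ?_⟩
    rw [hℳA, hℳB]
    apply le_antisymm
    · rintro _ ⟨_, ⟨x, hxm, rfl⟩, rfl⟩
      refine ⟨f x, ?_, rfl⟩
      rw [h𝒢] at hxm ⊢
      exact Stmt9.L_mem _ _ _ hxm
    · rintro _ ⟨x, hxm, rfl⟩
      refine ⟨_, ⟨f.symm x, ?_, rfl⟩, ?_⟩
      · rw [h𝒢] at hxm ⊢
        exact Stmt9.L_mem _ _ _ hxm
      · change NB.mkQ (f (f.symm x)) = NB.mkQ x
        rw [f.apply_symm_apply]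
end

section
/- Suppose e_1, e_2, e_3 ∈ R̄_c are linearly independent over k, where c > m − d + 1. For a pair A = (A_x, A_y) of n×n matrices over k, let W(A) ⊆ (R̄_c)^n be the k-subspace spanned by the columns of the matrix I·e_1 + A_x·e_2 + A_y·e_3, and set M_A = R̄^n/⟨W(A)⟩. Then M_A is decomposable as a graded R-module if and only if there is a nontrivial direct sum decomposition k^n = V ⊕ V' with V, V' both invariant under A_x and under A_y. -/
open DirectSum in
lemma aux_eps {k R : Type} [Field k] [CommRing R] [Algebra k R] [Nontrivial R]
    (𝒜 : ℕ → Submodule k R) [GradedAlgebra 𝒜] (h0 : 𝒜 0 = (1 : Submodule k R)) :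
    ∃ ε : R →+* k, ∀ r, (decompose 𝒜 r 0 : R) = algebraMap k R (ε r) := by
  have h : ∀ r : R, ∃ t : k, algebraMap k R t = (decompose 𝒜 r 0 : R) := by
    intro r
    have h : (decompose 𝒜 r 0 : R) ∈ (1 : Submodule k R) := h0.le (decompose 𝒜 r 0).2
    exact Submodule.mem_one.1 h
  choose f hf using h
  have inj : Function.Injective (algebraMap k R) := (algebraMap k R).injective
  have hp : ∀ r, (decompose 𝒜 r 0 : R) = GradedRing.projZeroRingHom 𝒜 r := fun r => rfl
  simp only [hp] at hf
  refine ⟨{ toFun := f, map_one' := ?_, map_mul' := ?_, map_zero' := ?_, map_add' := ?_ }, ?_⟩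
  · apply inj; rw [hf]; simp only [map_one]
  · intro a b; apply inj; rw [hf]; simp only [map_mul, hf]
  · apply inj; rw [hf]; simp only [map_zero]
  · intro a b; apply inj; rw [hf]; simp only [map_add, hf]
  · intro r; exact (hf r).symm

open DirectSum in
lemma aux_comp {k R : Type} [Field k] [CommRing R] [Algebra k R]
    (𝒜 : ℕ → Submodule k R) [GradedAlgebra 𝒜] (ε : R →+* k)
    (hε : ∀ r, (decompose 𝒜 r 0 : R) = algebraMap k R (ε r))
    (I : Ideal R) (hI : I.IsHomogeneous 𝒜) (c n : ℕ) (x : R) (hx : x ∈ 𝒜 c)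
    (F : Fin n → R) (hF : ∀ j, F j ∈ 𝒜 c) (r : Fin n → R)
    (h : Ideal.Quotient.mk I x = Ideal.Quotient.mk I (∑ j, r j * F j)) :
    Ideal.Quotient.mk I x = ∑ j, ε (r j) • Ideal.Quotient.mk I (F j) := by
  rw [Ideal.Quotient.eq] at h
  have h2 := hI c h
  have h3 : (decompose 𝒜 (x - ∑ j, r j * F j) c : R) = x - ∑ j, algebraMap k R (ε (r j)) * F j := by
    have e : ∀ z, (decompose 𝒜 z c : R) = GradedRing.proj 𝒜 c z := fun z => rfl
    rw [e, map_sub, map_sum, ← e, decompose_of_mem_same 𝒜 hx]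
    congr 1
    refine Finset.sum_congr rfl fun j _ => ?_
    rw [← e, coe_decompose_mul_of_right_mem_of_le 𝒜 (hF j) le_rfl, Nat.sub_self, hε]
  rw [h3] at h2
  rw [← Ideal.Quotient.eq] at h2
  rw [h2, map_sum]
  refine Finset.sum_congr rfl fun j _ => ?_
  rw [map_mul, Algebra.smul_def]
  rfl



/-- Suppose `e₁, e₂, e₃ ∈ R̄_c` are linearly independent over `k`, where
`c > m - d + 1`.  For a pair `A = (Ax, Ay)` of `n×n` matrices over `k`, let
`W(A) ⊆ (R̄_c)ⁿ` be the `k`-subspace spanned by the columns of `I·e₁ + Ax·e₂ + Ay·e₃`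
and `M_A = R̄ⁿ/⟨W(A)⟩`.  Then `M_A` is decomposable as a graded `R`-module iff there is a
nontrivial direct sum decomposition `kⁿ = V ⊕ V'` with `V`, `V'` invariant under `Ax` and
`Ay`.  (A submodule of a graded module is graded iff it is spanned by its homogeneous
elements.) -/
theorem stmt_10
    (k R : Type) [Field k] [Infinite k] [CommRing R] [Algebra k R]
    (𝒜 : ℕ → Submodule k R) [GradedAlgebra 𝒜]
    (h0 : 𝒜 0 = (1 : Submodule k R))
    (hstd : Algebra.adjoin k ((𝒜 1 : Submodule k R) : Set R) = ⊤)
    (d : ℕ) (hdim : ringKrullDim R = d)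
    (mdeg : Fin d → ℕ) (hmdeg : ∀ i, 0 < mdeg i)
    (y : Fin d → R) (hyhom : ∀ i, y i ∈ 𝒜 (mdeg i))
    (hyreg : RingTheory.Sequence.IsRegular R (List.ofFn y))
    (m : ℕ) (hm : m = ∑ i, mdeg i)
    (c : ℕ) (hc : m - d + 1 < c)
    (n : ℕ) (hn : 0 < n) :
    -- `R̄ = R/(y)` with its induced grading, and the grading on `R̄ⁿ`
    ∀ (I : Ideal R), I = Ideal.span (Set.range y) →
    ∀ (𝒜bar : ℕ → Submodule k (R ⧸ I)),
      (∀ i, 𝒜bar i = (𝒜 i).map (Ideal.Quotient.mkₐ k I).toLinearMap) →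
    ∀ (𝒢 : ℕ → Submodule k (Fin n → R ⧸ I)),
      (∀ p, 𝒢 p = Submodule.pi Set.univ fun _ => 𝒜bar p) →
    -- `e₁, e₂, e₃ ∈ R̄_c` linearly independent over `k`
    ∀ (e₁ e₂ e₃ : R ⧸ I), e₁ ∈ 𝒜bar c → e₂ ∈ 𝒜bar c → e₃ ∈ 𝒜bar c →
      LinearIndependent k ![e₁, e₂, e₃] →
    -- the matrix pair and the columns of `I·e₁ + Ax·e₂ + Ay·e₃`
    ∀ (Ax Ay : Matrix (Fin n) (Fin n) k),
    ∀ (colA : Fin n → (Fin n → R ⧸ I)),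
      (∀ j i, colA j i = (if i = j then e₁ else 0) + Ax i j • e₂ + Ay i j • e₃) →
    -- `W(A)` and `M_A = R̄ⁿ/⟨W(A)⟩` with its induced grading
    ∀ (NA : Submodule R (Fin n → R ⧸ I)),
      NA = Submodule.span R (Set.range colA) →
    ∀ (ℳA : ℕ → Submodule k ((Fin n → R ⧸ I) ⧸ NA)),
      (∀ p, ℳA p = (𝒢 p).map (NA.mkQ.restrictScalars k)) →
    -- `M_A` decomposable as graded `R`-module ↔ nontrivial simultaneous invariant decomposition
    ((∃ N N' : Submodule R ((Fin n → R ⧸ I) ⧸ NA),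
        N ≠ ⊥ ∧ N' ≠ ⊥ ∧ IsCompl N N' ∧
        N = Submodule.span R {x | x ∈ N ∧ ∃ p, x ∈ ℳA p} ∧
        N' = Submodule.span R {x | x ∈ N' ∧ ∃ p, x ∈ ℳA p})
      ↔ (∃ V V' : Submodule k (Fin n → k),
          V ≠ ⊥ ∧ V' ≠ ⊥ ∧ IsCompl V V' ∧
          (∀ v ∈ V, Ax.mulVecLin v ∈ V) ∧ (∀ v ∈ V, Ay.mulVecLin v ∈ V) ∧
          (∀ v ∈ V', Ax.mulVecLin v ∈ V') ∧ (∀ v ∈ V', Ay.mulVecLin v ∈ V'))) := by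
  intro I hI 𝒜bar hbar 𝒢 h𝒢 e₁ e₂ e₃ he₁ he₂ he₃ hli Ax Ay colA hcol NA hNA ℳA hℳ
  have hc0 : c ≠ 0 := by omega
  -- nontriviality
  have hne1 : e₁ ≠ 0 := hli.ne_zero 0
  have : Nontrivial (R ⧸ I) := ⟨⟨e₁, 0, hne1⟩⟩
  have : Nontrivial R := (Ideal.Quotient.mk_surjective (I := I)).nontrivial
  obtain ⟨ε, hε⟩ := aux_eps 𝒜 h0
  have injR : Function.Injective (algebraMap k R) := (algebraMap k R).injective
  have hεalg : ∀ t : k, ε (algebraMap k R t) = t := by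
    intro t
    apply injR
    rw [← hε]
    apply DirectSum.decompose_of_mem_same
    rw [h0]
    exact Submodule.mem_one.2 ⟨t, rfl⟩
  have hεpos : ∀ p, p ≠ 0 → ∀ r ∈ 𝒜 p, ε r = 0 := by
    intro p hp r hr
    apply injR
    rw [← hε, map_zero]
    exact DirectSum.decompose_of_mem_ne 𝒜 hr hp
  have hIhom : I.IsHomogeneous 𝒜 := by
    rw [hI]
    apply Ideal.homogeneous_span
    rintro _ ⟨i, rfl⟩
    exact ⟨_, hyhom i⟩
  have hεI : ∀ r ∈ I, ε r = 0 := by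
    intro r hr
    have : I ≤ RingHom.ker ε := by
      rw [hI, Ideal.span_le]
      rintro _ ⟨i, rfl⟩
      exact hεpos _ (hmdeg i).ne' _ (hyhom i)
    exact this hr
  rw [hbar] at he₁ he₂ he₃
  obtain ⟨E₁, hE₁, rfl⟩ := he₁
  obtain ⟨E₂, hE₂, rfl⟩ := he₂
  obtain ⟨E₃, hE₃, rfl⟩ := he₃
  -- constants
  let κ : (Fin n → k) →ₗ[k] (Fin n → R ⧸ I) :=
    { toFun := fun v i => algebraMap k (R ⧸ I) (v i)
      map_add' := by intro a b; ext i; simp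
      map_smul' := by intro a b; ext i; simp [Algebra.smul_def] }
  have hκ : ∀ v i, κ v i = algebraMap k (R ⧸ I) (v i) := fun _ _ => rfl
  let φ : (Fin n → k) →ₗ[k] ((Fin n → R ⧸ I) ⧸ NA) := (NA.mkQ.restrictScalars k) ∘ₗ κ
  have hφ : ∀ v, φ v = NA.mkQ (κ v) := fun _ => rfl
  let G : (Fin n → k) → (Fin n → R ⧸ I) := fun u =>
    E₁ • κ u + E₂ • κ (Ax.mulVecLin u) + E₃ • κ (Ay.mulVecLin u)
  have hsm : ∀ (E : R) (t : k), E • algebraMap k (R ⧸ I) t = t • Ideal.Quotient.mk I E := by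
    intro E t
    rw [Algebra.smul_def t, Algebra.smul_def E, mul_comm]
    rfl
  have hG : ∀ u, G u = ∑ j, u j • colA j := by
    intro u
    ext i
    simp only [G, Pi.add_apply, Pi.smul_apply, hκ, hsm, Finset.sum_apply, hcol, smul_add,
      Finset.sum_add_distrib, Matrix.mulVecLin_apply, Matrix.mulVec, dotProduct, Finset.sum_smul]
    refine congrArg₂ (· + ·) (congrArg₂ (· + ·) ?_ ?_) ?_
    · simp
    · refine Finset.sum_congr rfl fun j _ => ?_
      rw [smul_smul, mul_comm]; rfl
    · refine Finset.sum_congr rfl fun j _ => ?_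
      rw [smul_smul, mul_comm]; rfl
  have hGNA : ∀ u, G u ∈ NA := by
    intro u
    rw [hG, hNA]
    refine Submodule.sum_mem _ fun j _ => ?_
    rw [← algebraMap_smul R (u j) (colA j)]
    exact Submodule.smul_mem _ _ (Submodule.subset_span ⟨j, rfl⟩)
  have hcolG : ∀ j, colA j = G (Pi.single j 1) := by
    intro j
    rw [hG]
    rw [Finset.sum_eq_single j]
    · simp
    · intro b _ hb; simp [Pi.single_eq_of_ne hb]
    · simp
  have hrel : ∀ u, E₁ • φ u + E₂ • φ (Ax.mulVecLin u) + E₃ • φ (Ay.mulVecLin u) = 0 := by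
    intro u
    have := (Submodule.Quotient.mk_eq_zero NA).2 (hGNA u)
    rw [← this]
    rfl
  -- lemma L
  have hL : ∀ u a b, E₁ • φ u + E₂ • φ a + E₃ • φ b = 0 →
      a = Ax.mulVecLin u ∧ b = Ay.mulVecLin u := by
    intro u a b h
    have h1 : E₁ • κ u + E₂ • κ a + E₃ • κ b ∈ NA := by
      rw [← Submodule.Quotient.mk_eq_zero NA, ← h]
      rfl
    rw [hNA, Submodule.mem_span_range_iff_exists_fun] at h1
    obtain ⟨r, hr⟩ := h1
    have key : ∀ i, u i = ε (r i) ∧ a i = ∑ j, Ax i j * ε (r j) ∧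
        b i = ∑ j, Ay i j * ε (r j) := by
      intro i
      have hri := congrFun hr i
      let F : Fin n → R := fun j => (if i = j then E₁ else 0) + Ax i j • E₂ + Ay i j • E₃
      have hFc : ∀ j, Ideal.Quotient.mk I (F j) = colA j i := by
        intro j
        rw [hcol]
        simp only [F, map_add]
        congr 2
        · split_ifs <;> simp
      have := aux_comp 𝒜 ε hε I hIhom c n (u i • E₁ + a i • E₂ + b i • E₃)
        (add_mem (add_mem (Submodule.smul_mem _ _ hE₁) (Submodule.smul_mem _ _ hE₂))
          (Submodule.smul_mem _ _ hE₃)) F (by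
          intro j
          refine add_mem (add_mem ?_ (Submodule.smul_mem _ _ hE₂)) (Submodule.smul_mem _ _ hE₃)
          split_ifs
          · exact hE₁
          · exact zero_mem _) r (by
          rw [map_sum]
          simp only [map_mul, hFc]
          simp only [Finset.sum_apply, Pi.smul_apply, Pi.add_apply, hκ, hsm] at hri
          exact hri.symm)
      simp only [hFc, hcol, smul_add, Finset.sum_add_distrib] at this
      have e1 : ∑ j, ε (r j) • (if i = j then (Ideal.Quotient.mkₐ k I).toLinearMap E₁ else 0)
          = ε (r i) • (Ideal.Quotient.mkₐ k I).toLinearMap E₁ := by simp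
      rw [e1] at this
      simp only [smul_smul, ← Finset.sum_smul] at this
      have h5 : (u i - ε (r i)) • (Ideal.Quotient.mkₐ k I).toLinearMap E₁ +
          (a i - ∑ j, ε (r j) * Ax i j) • (Ideal.Quotient.mkₐ k I).toLinearMap E₂ +
          (b i - ∑ j, ε (r j) * Ay i j) • (Ideal.Quotient.mkₐ k I).toLinearMap E₃ = 0 := by
        have h6 : u i • (Ideal.Quotient.mkₐ k I).toLinearMap E₁ +
          a i • (Ideal.Quotient.mkₐ k I).toLinearMap E₂ +
          b i • (Ideal.Quotient.mkₐ k I).toLinearMap E₃ = _ := this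
        simp only [sub_smul]
        rw [← sub_eq_zero] at h6
        rw [← h6]
        abel
      have h7 := Fintype.linearIndependent_iff.1 hli
        ![u i - ε (r i), a i - ∑ j, ε (r j) * Ax i j, b i - ∑ j, ε (r j) * Ay i j]
        (by simpa [Fin.sum_univ_three] using h5)
      refine ⟨sub_eq_zero.1 (h7 0), ?_, ?_⟩
      · rw [sub_eq_zero.1 (h7 1)]
        exact Finset.sum_congr rfl fun j _ => mul_comm _ _
      · rw [sub_eq_zero.1 (h7 2)]
        exact Finset.sum_congr rfl fun j _ => mul_comm _ _
    have hu : u = fun i => ε (r i) := funext fun i => (key i).1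
    subst hu
    exact ⟨funext fun i => (key i).2.1, funext fun i => (key i).2.2⟩
  -- augmentation
  let εb : R ⧸ I →+* k := Ideal.Quotient.lift I ε hεI
  have hεb : ∀ r, εb (Ideal.Quotient.mk I r) = ε r := fun r => Ideal.Quotient.lift_mk _ _ _
  have hεb0 : ∀ p, p ≠ 0 → ∀ x ∈ 𝒜bar p, εb x = 0 := by
    intro p hp x hx
    rw [hbar] at hx
    obtain ⟨r, hr, rfl⟩ := hx
    exact (hεb r).trans (hεpos p hp r hr)
  have hεbalg : ∀ t, εb (algebraMap k (R ⧸ I) t) = t := fun t => (hεb _).trans (hεalg t)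
  let f : (Fin n → R ⧸ I) →ₛₗ[ε] (Fin n → k) :=
    { toFun := fun v i => εb (v i)
      map_add' := by intro a b; ext i; simp
      map_smul' := by
        intro a b; ext i
        simp only [Pi.smul_apply, Algebra.smul_def, map_mul]
        congr 1 }
  have hfNA : NA ≤ LinearMap.ker f := by
    rw [hNA, Submodule.span_le]
    rintro _ ⟨j, rfl⟩
    change f (colA j) = 0
    ext i
    change εb (colA j i) = 0
    apply hεb0 c hc0
    rw [hcol, hbar]
    refine add_mem (add_mem ?_ (Submodule.smul_mem _ _ ⟨_, hE₂, rfl⟩))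
      (Submodule.smul_mem _ _ ⟨_, hE₃, rfl⟩)
    split_ifs
    · exact ⟨_, hE₁, rfl⟩
    · exact zero_mem _
  let Ψ : ((Fin n → R ⧸ I) ⧸ NA) →ₛₗ[ε] (Fin n → k) := NA.liftQ f hfNA
  have hΨ : ∀ x, Ψ (NA.mkQ x) = fun i => εb (x i) := fun x => rfl
  have hΨφ : ∀ v, Ψ (φ v) = v := by
    intro v
    rw [hφ, hΨ]
    ext i
    rw [hκ, hεbalg]
  have hφinj : ∀ v, φ v = 0 → v = 0 := by
    intro v hv
    rw [← hΨφ v, hv, map_zero]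
  have hφspan : ∀ N : Submodule R ((Fin n → R ⧸ I) ⧸ NA), (∀ v, φ v ∈ N) → N = ⊤ := by
    intro N hN
    rw [eq_top_iff]
    rintro x -
    obtain ⟨x, rfl⟩ := NA.mkQ_surjective x
    choose r hr using fun i => Ideal.Quotient.mk_surjective (x i)
    have : x = ∑ j, r j • κ (Pi.single j 1) := by
      ext i
      rw [Finset.sum_apply, Finset.sum_eq_single i]
      · rw [Pi.smul_apply, hκ, hsm]; simp [hr]
      · intro b _ hb; rw [Pi.smul_apply, hκ, hsm]; simp [Pi.single_eq_of_ne hb.symm]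
      · simp
    rw [this, map_sum]
    refine Submodule.sum_mem _ fun j _ => ?_
    rw [map_smul]
    exact Submodule.smul_mem _ _ (hN _)
  have hφ0 : ∀ v, φ v ∈ ℳA 0 := by
    intro v
    rw [hℳ]
    refine ⟨κ v, ?_, rfl⟩
    rw [h𝒢]
    intro i _
    change κ v i ∈ 𝒜bar 0
    rw [hbar]
    refine ⟨algebraMap k R (v i), ?_, rfl⟩
    rw [h0]
    exact Submodule.mem_one.2 ⟨_, rfl⟩
  have hφΨ0 : ∀ x ∈ ℳA 0, φ (Ψ x) = x := by
    intro x hx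
    rw [hℳ] at hx
    obtain ⟨x, hx, rfl⟩ := hx
    rw [h𝒢] at hx
    have : ∃ v, κ v = x := by
      have : ∀ i, ∃ t, algebraMap k (R ⧸ I) t = x i := by
        intro i
        have := hx i trivial
        change x i ∈ 𝒜bar 0 at this
        rw [hbar, h0] at this
        obtain ⟨r, hr, hrx⟩ := this
        obtain ⟨t, rfl⟩ := Submodule.mem_one.1 hr
        exact ⟨t, hrx⟩
      choose v hv using this
      exact ⟨v, funext hv⟩
    obtain ⟨v, rfl⟩ := this
    change φ (Ψ (φ v)) = φ v
    rw [hΨφ]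
  have hΨp : ∀ p, p ≠ 0 → ∀ x ∈ ℳA p, Ψ x = 0 := by
    intro p hp x hx
    rw [hℳ] at hx
    obtain ⟨x, hx, rfl⟩ := hx
    rw [h𝒢] at hx
    change Ψ (NA.mkQ x) = 0
    rw [hΨ]
    ext i
    exact hεb0 p hp _ (hx i trivial)
  have hφΨN : ∀ N : Submodule R ((Fin n → R ⧸ I) ⧸ NA),
      N = Submodule.span R {x | x ∈ N ∧ ∃ p, x ∈ ℳA p} → ∀ x ∈ N, φ (Ψ x) ∈ N := by
    intro N hN x hx
    rw [hN] at hx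
    induction hx using Submodule.span_induction with
    | mem x h =>
      obtain ⟨hxN, p, hp⟩ := h
      by_cases h : p = 0
      · subst h; rwa [hφΨ0 x hp]
      · rw [hΨp p h x hp, map_zero]; exact zero_mem _
    | zero => rw [map_zero, map_zero]; exact zero_mem _
    | add x y _ _ hx hy => rw [map_add, map_add]; exact add_mem hx hy
    | smul a x _ hx =>
      rw [LinearMap.map_smulₛₗ, map_smul, ← algebraMap_smul R]
      exact Submodule.smul_mem _ _ hx
  constructor
  · rintro ⟨N, N', hN, hN', hcompl, hgN, hgN'⟩
    have inv : ∀ N N' : Submodule R ((Fin n → R ⧸ I) ⧸ NA), IsCompl N N' →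
        N = Submodule.span R {x | x ∈ N ∧ ∃ p, x ∈ ℳA p} →
        N' = Submodule.span R {x | x ∈ N' ∧ ∃ p, x ∈ ℳA p} →
        (∀ v, ∃ a a', φ a ∈ N ∧ φ a' ∈ N' ∧ v = a + a') ∧
        ∀ v, φ v ∈ N → φ (Ax.mulVecLin v) ∈ N ∧ φ (Ay.mulVecLin v) ∈ N := by
      intro N N' hcompl hgN hgN'
      have hdec : ∀ v, ∃ a a', φ a ∈ N ∧ φ a' ∈ N' ∧ v = a + a' := by
        intro v
        have : φ v ∈ N ⊔ N' := by rw [hcompl.sup_eq_top]; trivial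
        obtain ⟨x, hx, x', hx', hxx⟩ := Submodule.mem_sup.1 this
        refine ⟨Ψ x, Ψ x', hφΨN N hgN x hx, hφΨN N' hgN' x' hx', ?_⟩
        rw [← map_add, hxx, hΨφ]
      refine ⟨hdec, ?_⟩
      intro v hv
      obtain ⟨a, a', ha, ha', haa⟩ := hdec (Ax.mulVecLin v)
      obtain ⟨b, b', hb, hb', hbb⟩ := hdec (Ay.mulVecLin v)
      have h1 := hrel v
      rw [haa, hbb, map_add, map_add, smul_add, smul_add] at h1
      have h2 : E₂ • φ a' + E₃ • φ b' = -(E₁ • φ v + E₂ • φ a + E₃ • φ b) := by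
        rw [eq_neg_iff_add_eq_zero, ← h1]; abel
      have h3 : E₂ • φ a' + E₃ • φ b' ∈ N' :=
        add_mem (Submodule.smul_mem _ _ ha') (Submodule.smul_mem _ _ hb')
      have h4 : E₂ • φ a' + E₃ • φ b' ∈ N := by
        rw [h2]
        exact neg_mem (add_mem (add_mem (Submodule.smul_mem _ _ hv) (Submodule.smul_mem _ _ ha))
          (Submodule.smul_mem _ _ hb))
      have h5 := Submodule.disjoint_def.1 hcompl.disjoint _ h4 h3
      have h6 := hL 0 a' b' (by rw [map_zero, smul_zero, zero_add, h5])
      rw [map_zero, map_zero] at h6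
      rw [haa, hbb, h6.1, h6.2, add_zero, add_zero]
      exact ⟨ha, hb⟩
    obtain ⟨hdec, hinv⟩ := inv N N' hcompl hgN hgN'
    obtain ⟨-, hinv'⟩ := inv N' N hcompl.symm hgN' hgN
    have hVne : ∀ N N' : Submodule R ((Fin n → R ⧸ I) ⧸ NA), N ≠ ⊥ → IsCompl N N' →
        (∀ v, ∃ a a', φ a ∈ N ∧ φ a' ∈ N' ∧ v = a + a') →
        (N.restrictScalars k).comap φ ≠ ⊥ := by
      intro N N' hN hcompl hdec hbot
      apply hN
      have : N' = ⊤ := by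
        apply hφspan
        intro v
        obtain ⟨a, a', ha, ha', rfl⟩ := hdec v
        have : a ∈ (N.restrictScalars k).comap φ := ha
        rw [hbot, Submodule.mem_bot] at this
        rw [this, zero_add]
        exact ha'
      have h := hcompl.inf_eq_bot
      rwa [this, inf_top_eq] at h
    refine ⟨(N.restrictScalars k).comap φ, (N'.restrictScalars k).comap φ,
      hVne N N' hN hcompl hdec, hVne N' N hN' hcompl.symm ?_, ⟨?_, ?_⟩,
      fun v hv => (hinv v hv).1, fun v hv => (hinv v hv).2,
      fun v hv => (hinv' v hv).1, fun v hv => (hinv' v hv).2⟩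
    · intro v
      obtain ⟨a, a', ha, ha', h⟩ := hdec v
      exact ⟨a', a, ha', ha, by rw [h, add_comm]⟩
    · rw [Submodule.disjoint_def]
      intro v hv hv'
      exact hφinj v (Submodule.disjoint_def.1 hcompl.disjoint _ hv hv')
    · rw [codisjoint_iff, eq_top_iff]
      rintro v -
      obtain ⟨a, a', ha, ha', h⟩ := hdec v
      exact Submodule.mem_sup.2 ⟨a, ha, a', ha', h.symm⟩
  · rintro ⟨V, V', hV, hV', hcompl, hxV, hyV, hxV', hyV'⟩
    have hne : ∀ V : Submodule k (Fin n → k), V ≠ ⊥ → Submodule.span R (φ '' V) ≠ ⊥ := by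
      intro V hV h
      apply hV
      rw [eq_bot_iff]
      intro v hv
      have : φ v ∈ Submodule.span R (φ '' V) := Submodule.subset_span ⟨v, hv, rfl⟩
      rw [h, Submodule.mem_bot] at this
      exact hφinj v this
    have hgr : ∀ V : Submodule k (Fin n → k), Submodule.span R (φ '' V) =
        Submodule.span R {x | x ∈ Submodule.span R (φ '' V) ∧ ∃ p, x ∈ ℳA p} := by
      intro V
      apply le_antisymm
      · apply Submodule.span_mono
        rintro _ ⟨v, hv, rfl⟩
        exact ⟨Submodule.subset_span ⟨v, hv, rfl⟩, 0, hφ0 v⟩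
      · rw [Submodule.span_le]
        exact fun x hx => hx.1
    refine ⟨_, _, hne V hV, hne V' hV', ⟨?_, ?_⟩, hgr V, hgr V'⟩
    · obtain ⟨P, hP, hP'⟩ : ∃ P : (Fin n → k) →ₗ[k] (Fin n → k),
          (∀ v ∈ V, P v = v) ∧ ∀ v ∈ V', P v = 0 := by
        refine ⟨V.subtype ∘ₗ V.projectionOnto V' hcompl, ?_, ?_⟩
        · intro v hv
          exact congrArg Subtype.val (Submodule.projectionOnto_apply_left hcompl ⟨v, hv⟩)
        · intro v hv
          exact congrArg Subtype.val (Submodule.projectionOnto_apply_right hcompl ⟨v, hv⟩)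
      have hcomm : ∀ A : Matrix (Fin n) (Fin n) k, (∀ v ∈ V, A.mulVecLin v ∈ V) →
          (∀ v ∈ V', A.mulVecLin v ∈ V') → ∀ v, P (A.mulVecLin v) = A.mulVecLin (P v) := by
        intro A h h' v
        have : v ∈ V ⊔ V' := by rw [hcompl.sup_eq_top]; trivial
        obtain ⟨a, ha, b, hb, rfl⟩ := Submodule.mem_sup.1 this
        rw [map_add, map_add, map_add, map_add, hP a ha, hP _ (h a ha), hP' b hb, hP' _ (h' b hb),
          map_zero]
      let g : (Fin n → R ⧸ I) →ₗ[R] (Fin n → R ⧸ I) :=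
        { toFun := fun x i => ∑ j, P.toMatrix' i j • x j
          map_add' := by intro a b; ext i; simp [Finset.sum_add_distrib]
          map_smul' := by
            intro a b; ext i
            simp only [Pi.smul_apply, RingHom.id_apply, Finset.smul_sum]
            exact Finset.sum_congr rfl fun j _ => smul_comm _ _ _ }
      have hg : ∀ v, g (κ v) = κ (P v) := by
        intro v
        ext i
        change ∑ j, P.toMatrix' i j • algebraMap k (R ⧸ I) (v j) = algebraMap k (R ⧸ I) (P v i)
        conv_rhs => rw [← LinearMap.toMatrix'_mulVec P v]
        simp [Matrix.mulVec, dotProduct, Algebra.smul_def]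
      have hgNA : NA ≤ NA.comap g := by
        conv_lhs => rw [hNA]
        rw [Submodule.span_le]
        rintro _ ⟨j, rfl⟩
        change g (colA j) ∈ NA
        rw [hcolG]
        have : g (G (Pi.single j 1)) = G (P (Pi.single j 1)) := by
          simp only [G, map_add, map_smul, hg, hcomm Ax hxV hxV', hcomm Ay hyV hyV']
        rw [this]
        exact hGNA _
      let Q := NA.mapQ NA g hgNA
      have hQ : ∀ v, Q (φ v) = φ (P v) := by
        intro v
        rw [hφ, hφ, ← hg]
        rfl
      have hQ1 : ∀ x ∈ Submodule.span R (φ '' V), Q x = x := by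
        intro x hx
        have : Submodule.span R (φ '' V) ≤ LinearMap.eqLocus Q LinearMap.id := by
          rw [Submodule.span_le]
          rintro _ ⟨v, hv, rfl⟩
          change Q (φ v) = φ v
          rw [hQ, hP v hv]
        exact this hx
      have hQ2 : ∀ x ∈ Submodule.span R (φ '' V'), Q x = 0 := by
        intro x hx
        have : Submodule.span R (φ '' V') ≤ LinearMap.ker Q := by
          rw [Submodule.span_le]
          rintro _ ⟨v, hv, rfl⟩
          change Q (φ v) = 0
          rw [hQ, hP' v hv, map_zero]
        exact this hx
      rw [Submodule.disjoint_def]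
      intro x hx hx'
      rw [← hQ1 x hx, hQ2 x hx']
    · rw [codisjoint_iff]
      apply hφspan
      intro v
      have : v ∈ V ⊔ V' := by rw [hcompl.sup_eq_top]; trivial
      obtain ⟨a, ha, b, hb, rfl⟩ := Submodule.mem_sup.1 this
      rw [map_add]
      exact Submodule.add_mem_sup (Submodule.subset_span ⟨a, ha, rfl⟩)
        (Submodule.subset_span ⟨b, hb, rfl⟩)
end

section
/- Let R = k[x_0, …, x_n]/(f) where n ≥ 2 and f is a nonzero homogeneous polynomial of degree e ≥ 4 (so R is a standard graded Cohen–Macaulay algebra of Krull dimension n). Then there exists an R-regular sequence y_1, …, y_n of homogeneous elements of positive degrees, with m = Σ deg y_i, and an integer c > m − n + 1 such that dim_k (R/(y_1,…,y_n))_c ≥ 3. -/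
set_option synthInstance.maxHeartbeats 1000000
set_option maxHeartbeats 2000000

open RingTheory.Sequence in
theorem aux_supportDim_le {R : Type*} [CommRing R] (rs : List R) :
    ∀ {M : Type _} [AddCommGroup M] [Module R M] [Module.Finite R M], IsRegular M rs →
      (rs.length : WithBot ℕ∞) ≤ Module.supportDim R M := by
  induction rs with
  | nil =>
    intro M _ _ _ h
    have : Nontrivial M := by
      by_contra hM
      rw [not_nontrivial_iff_subsingleton] at hM
      exact h.2 (Subsingleton.elim _ _)
    have h0 := Module.supportDim_ne_bot_of_nontrivial R M
    cases hd : Module.supportDim R M with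
    | bot => exact absurd hd h0
    | coe x => simp [WithBot.coe_nonneg]
  | cons x rs ih =>
    intro M _ _ _ h
    obtain ⟨h1, h2⟩ := (isRegular_cons_iff M _ _).mp h
    have h3 := Module.supportDim_quotSMulTop_succ_le_of_notMem_minimalPrimes (R := R) (M := M)
      (x := x) (fun _ ↦ h1.notMem_of_mem_minimalPrimes)
    refine le_trans ?_ h3
    have := ih h2
    push_cast [List.length_cons]
    gcongr

theorem aux_dim_lower {R : Type*} [CommRing R] (rs : List R)
    (h : RingTheory.Sequence.IsRegular R rs) : (rs.length : WithBot ℕ∞) ≤ ringKrullDim R := by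
  rw [← Module.supportDim_self_eq_ringKrullDim]
  exact aux_supportDim_le rs h

open MvPolynomial in
theorem aux_mem_span {k : Type*} [Field k] {n : ℕ} (d : Fin n → ℕ) (s : Set (Fin n))
    (p : MvPolynomial (Fin n) k) :
    p ∈ Ideal.span ((fun i => (X i : MvPolynomial (Fin n) k) ^ d i) '' s) ↔
      ∀ m ∈ p.support, ∃ i ∈ s, d i ≤ m i := by
  have h : (fun i => (X i : MvPolynomial (Fin n) k) ^ d i) '' s =
      (fun t => monomial t (1 : k)) '' ((fun i => Finsupp.single i (d i)) '' s) := by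
    rw [Set.image_image]
    simp [X_pow_eq_monomial]
  rw [h, mem_ideal_span_monomial_image]
  simp

open MvPolynomial in
theorem aux_regular {k : Type*} [Field k] {n : ℕ} (d : Fin n → ℕ) (hd : ∀ i, 0 < d i) :
    RingTheory.Sequence.IsRegular (MvPolynomial (Fin n) k)
      (List.ofFn fun i => (X i : MvPolynomial (Fin n) k) ^ d i) := by
  have key : ∀ j, (Ideal.ofList ((List.ofFn fun i => (X i : MvPolynomial (Fin n) k) ^ d i).take j)
      • (⊤ : Submodule (MvPolynomial (Fin n) k) (MvPolynomial (Fin n) k)))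
      = Ideal.span ((fun i => (X i : MvPolynomial (Fin n) k) ^ d i) '' {i | i.val < j}) := by
    intro j
    rw [smul_eq_mul, Ideal.mul_top, Ideal.ofList]
    congr 1
    ext p
    simp only [Set.mem_ofPred_eq, List.mem_take_iff_getElem, Set.mem_image]
    constructor
    · rintro ⟨i, hi, rfl⟩
      simp at hi
      exact ⟨⟨i, hi.2⟩, hi.1, by simp⟩
    · rintro ⟨i, hi, rfl⟩
      exact ⟨i.val, by simp [hi], by simp⟩
  refine ⟨⟨?_⟩, ?_⟩
  · intro j hj
    rw [key]
    simp at hj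
    rw [isSMulRegular_iff_right_eq_zero_of_smul]
    intro x
    obtain ⟨p, rfl⟩ := Submodule.Quotient.mk_surjective _ x
    rw [← Submodule.Quotient.mk_smul, Submodule.Quotient.mk_eq_zero, Submodule.Quotient.mk_eq_zero,
      aux_mem_span, aux_mem_span]
    intro h m hm
    have := h (m + Finsupp.single ⟨j, hj⟩ (d ⟨j, hj⟩)) (by
      simp only [List.getElem_ofFn, smul_eq_mul, mem_support_iff] at hm ⊢
      rw [X_pow_eq_monomial, add_comm, coeff_monomial_mul]
      simpa using hm)
    obtain ⟨i, hi, hi2⟩ := this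
    refine ⟨i, hi, ?_⟩
    have hne : (⟨j, hj⟩ : Fin n) ≠ i := by
      rintro rfl
      simp at hi
    simpa [Finsupp.single_apply, hne] using hi2
  · have h := key n
    rw [List.take_of_length_le (by simp)] at h
    rw [h]
    intro h1
    have : (1 : MvPolynomial (Fin n) k) ∈ Ideal.span ((fun i => (X i : MvPolynomial (Fin n) k) ^ d i) '' {i | i.val < n}) := by
      rw [← h1]; trivial
    rw [aux_mem_span] at this
    obtain ⟨i, _, hi⟩ := this 0 (by simp)
    simp at hi
    exact absurd hi (hd i).ne'

/-- the degrees -/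
def auxDeg (n : ℕ) (i : Fin n) : ℕ := if i.val < 2 then 2 else 1

theorem auxDeg_sum (n : ℕ) (hn : 2 ≤ n) : ∑ i, auxDeg n i = n + 2 := by
  obtain ⟨m, rfl⟩ := Nat.exists_eq_add_of_le' hn
  rw [Fin.sum_univ_succ, Fin.sum_univ_succ]
  simp [auxDeg]
  omega

open MvPolynomial in
theorem aux_indep {k : Type*} [Field k] {n e : ℕ} (hn : 2 ≤ n) (he : 4 ≤ e)
    (F : Polynomial (MvPolynomial (Fin n) k)) (hF : F.Monic) (hFe : F.natDegree = e)
    (c : Fin 3 → k) (a b : Fin n) (ha : a.val = 0) (hb : b.val = 1)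
    (h : (F.map (Ideal.Quotient.mk (Ideal.span (Set.range fun i => (X i : MvPolynomial (Fin n) k) ^ auxDeg n i)))) ∣
      (Polynomial.C (C (c 0) * X a + C (c 1) * X b) * Polynomial.X ^ (e - 1)
        + Polynomial.C (C (c 2) * (X a * X b)) * Polynomial.X ^ (e - 2)).map (Ideal.Quotient.mk (Ideal.span (Set.range fun i => (X i : MvPolynomial (Fin n) k) ^ auxDeg n i)))) :
    c = 0 := by
  have hspan : Ideal.span (Set.range fun i => (X i : MvPolynomial (Fin n) k) ^ auxDeg n i) =
    Ideal.span ((fun i => (X i : MvPolynomial (Fin n) k) ^ auxDeg n i) '' Set.univ) := by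
    rw [Set.image_univ]
  set I := Ideal.span (Set.range fun i => (X i : MvPolynomial (Fin n) k) ^ auxDeg n i) with hI
  have hnt : Nontrivial (MvPolynomial (Fin n) k ⧸ I) := by
    rw [Ideal.Quotient.nontrivial_iff, Ideal.ne_top_iff_one, hspan, aux_mem_span]
    intro h
    obtain ⟨i, _, hi⟩ := h 0 (by simp)
    simp [auxDeg] at hi
    split_ifs at hi
  have hab : a ≠ b := by
    rintro rfl
    omega
  set G := (Polynomial.C (C (c 0) * X a + C (c 1) * X b) * Polynomial.X ^ (e - 1)
        + Polynomial.C (C (c 2) * (X a * X b)) * Polynomial.X ^ (e - 2) : Polynomial (MvPolynomial (Fin n) k)) with hG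
  have h0 : G.map (Ideal.Quotient.mk I) = 0 := by
    by_contra hG0
    refine (hF.map (Ideal.Quotient.mk I)).not_dvd_of_degree_lt hG0 ?_ h
    rw [hF.degree_map, Polynomial.degree_eq_natDegree hF.ne_zero, hFe]
    refine lt_of_le_of_lt Polynomial.degree_map_le ?_
    refine lt_of_le_of_lt (b := ((e - 1 : ℕ) : WithBot ℕ)) ?_ (by exact_mod_cast (by omega))
    refine (Polynomial.degree_add_le _ _).trans (max_le ?_ ?_)
    · exact Polynomial.degree_C_mul_X_pow_le _ _
    · refine (Polynomial.degree_C_mul_X_pow_le _ _).trans ?_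
      exact_mod_cast (by omega)
  have h1 : (C (c 0) * X a + C (c 1) * X b : MvPolynomial (Fin n) k) ∈ I := by
    have := congrArg (fun p => Polynomial.coeff p (e - 1)) h0
    simp only [Polynomial.coeff_map, Polynomial.coeff_zero] at this
    rw [Ideal.Quotient.eq_zero_iff_mem] at this
    rw [hG, Polynomial.coeff_add, Polynomial.coeff_C_mul, Polynomial.coeff_C_mul] at this
    simpa [Polynomial.coeff_X_pow, show e - 1 ≠ e - 2 by omega] using this
  have h2 : (C (c 2) * (X a * X b) : MvPolynomial (Fin n) k) ∈ I := by
    have := congrArg (fun p => Polynomial.coeff p (e - 2)) h0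
    simp only [Polynomial.coeff_map, Polynomial.coeff_zero] at this
    rw [Ideal.Quotient.eq_zero_iff_mem] at this
    rw [hG, Polynomial.coeff_add, Polynomial.coeff_C_mul, Polynomial.coeff_C_mul] at this
    simpa [Polynomial.coeff_X_pow, show e - 2 ≠ e - 1 by omega] using this
  rw [hspan, aux_mem_span] at h1 h2
  have hda : auxDeg n a = 2 := by simp [auxDeg, ha]
  have hdb : auxDeg n b = 2 := by simp [auxDeg, hb]
  have hpos : ∀ i, 0 < auxDeg n i := by intro i; unfold auxDeg; split_ifs <;> omega
  have e1 : (C (c 0) * X a + C (c 1) * X b : MvPolynomial (Fin n) k) =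
    monomial (Finsupp.single a 1) (c 0) + monomial (Finsupp.single b 1) (c 1) := by
    simp [C_mul_X_eq_monomial]
  have e2 : (C (c 2) * (X a * X b) : MvPolynomial (Fin n) k) =
    monomial (Finsupp.single a 1 + Finsupp.single b 1) (c 2) := by
    rw [← mul_assoc, C_mul_X_eq_monomial, X, monomial_mul, mul_one]
  rw [e1] at h1
  rw [e2] at h2
  have c0 : c 0 = 0 := by
    by_contra hc
    obtain ⟨i, _, hi⟩ := h1 (Finsupp.single a 1) (by
      simp [mem_support_iff, coeff_monomial, Finsupp.single_left_inj, hab.symm, hc])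
    have := hpos i
    by_cases hia : a = i
    · subst hia; simp [hda] at hi
    · simp [Finsupp.single_apply, hia] at hi; omega
  have c1 : c 1 = 0 := by
    by_contra hc
    obtain ⟨i, _, hi⟩ := h1 (Finsupp.single b 1) (by
      simp [mem_support_iff, coeff_monomial, Finsupp.single_left_inj, hab, hc])
    have := hpos i
    by_cases hia : b = i
    · subst hia; simp [hdb] at hi
    · simp [Finsupp.single_apply, hia] at hi; omega
  have c2 : c 2 = 0 := by
    by_contra hc
    obtain ⟨i, _, hi⟩ := h2 (Finsupp.single a 1 + Finsupp.single b 1) (by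
      simp [mem_support_iff, coeff_monomial, hc])
    have := hpos i
    by_cases hia : a = i
    · subst hia; simp [hda, hab, Finsupp.single_apply, hab.symm] at hi
    · by_cases hib : b = i
      · subst hib; simp [hdb, hab, Finsupp.single_apply, hab.symm] at hi
      · simp [Finsupp.single_apply, hia, hib] at hi; omega
  ext i
  fin_cases i <;> simp [c0, c1, c2]

theorem aux_dvd {A S ι : Type*} [CommRing A] [CommRing S] (ψ : S ≃+* Polynomial A)
    (F : Polynomial A) (J : Ideal S) (hJ : J = Ideal.span {ψ.symm F}) (I : Ideal A) (y : ι → A)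
    (hy : ∀ i, y i ∈ I) (p : Polynomial A)
    (hp : Ideal.Quotient.mk J (ψ.symm p) ∈
      Ideal.span (Set.range fun i => Ideal.Quotient.mk J (ψ.symm (Polynomial.C (y i))))) :
    F.map (Ideal.Quotient.mk I) ∣ p.map (Ideal.Quotient.mk I) := by
  let θ : (S ⧸ J) →+* (Polynomial (A ⧸ I) ⧸ Ideal.span {F.map (Ideal.Quotient.mk I)}) :=
    Ideal.Quotient.lift J (((Ideal.Quotient.mk _).comp
      (Polynomial.mapRingHom (Ideal.Quotient.mk I))).comp (ψ : S →+* Polynomial A)) (by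
        intro p hp
        rw [hJ, Ideal.mem_span_singleton] at hp
        obtain ⟨q, rfl⟩ := hp
        rw [RingHom.comp_apply, RingHom.comp_apply, Ideal.Quotient.eq_zero_iff_mem,
          Ideal.mem_span_singleton, map_mul, map_mul]
        simp)
  have hθ : ∀ p, θ (Ideal.Quotient.mk J (ψ.symm p)) =
      Ideal.Quotient.mk _ (p.map (Ideal.Quotient.mk I)) := by
    intro p
    simp [θ]
  have h3 : Ideal.span (Set.range fun i => Ideal.Quotient.mk J (ψ.symm (Polynomial.C (y i))))
      ≤ RingHom.ker θ := by
    rw [Ideal.span_le]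
    rintro _ ⟨i, rfl⟩
    rw [SetLike.mem_coe, RingHom.mem_ker, hθ, Polynomial.map_C,
      Ideal.Quotient.eq_zero_iff_mem.mpr (hy i)]
    simp
  have h4 := h3 hp
  rwa [RingHom.mem_ker, hθ, Ideal.Quotient.eq_zero_iff_mem, Ideal.mem_span_singleton] at h4

open MvPolynomial in
theorem aux_core (k : Type) [Field k] (n e : ℕ) (hn : 2 ≤ n) (he : 4 ≤ e)
    (ψ : MvPolynomial (Fin (n + 1)) k ≃ₐ[k] Polynomial (MvPolynomial (Fin n) k))
    (hψX : (ψ.symm Polynomial.X).IsHomogeneous 1)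
    (hψC : ∀ i, (ψ.symm (Polynomial.C (X i))).IsHomogeneous 1)
    (F : Polynomial (MvPolynomial (Fin n) k)) (hF : F.Monic) (hFe : F.natDegree = e)
    (J : Ideal (MvPolynomial (Fin (n + 1)) k)) (hJ : J = Ideal.span {ψ.symm F})
    (𝒜 : ℕ → Submodule k (MvPolynomial (Fin (n + 1)) k ⧸ J))
    (h𝒜 : ∀ i, 𝒜 i = (MvPolynomial.homogeneousSubmodule (Fin (n + 1)) k i).map
          (Ideal.Quotient.mkₐ k J).toLinearMap) :
    (ringKrullDim (MvPolynomial (Fin (n + 1)) k ⧸ J) = n) ∧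
    (∃ (mdeg : Fin n → ℕ) (y : Fin n → MvPolynomial (Fin (n + 1)) k ⧸ J),
      (∀ i, 0 < mdeg i) ∧ (∀ i, y i ∈ 𝒜 (mdeg i)) ∧
      RingTheory.Sequence.IsRegular (MvPolynomial (Fin (n + 1)) k ⧸ J) (List.ofFn y) ∧
      (∃ c : ℕ, (∑ i, mdeg i) - n + 1 < c ∧
        3 ≤ Module.finrank k
          ((𝒜 c).map (Ideal.Quotient.mkₐ k
            (Ideal.span (Set.range y))).toLinearMap))) := by
  have hpos : ∀ i, 0 < auxDeg n i := by intro i; unfold auxDeg; split_ifs <;> omega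
  let y : Fin n → MvPolynomial (Fin (n + 1)) k ⧸ J := fun i =>
    Ideal.Quotient.mk J (ψ.symm (Polynomial.C (X i ^ auxDeg n i)))
  have hreg : RingTheory.Sequence.IsRegular (MvPolynomial (Fin (n + 1)) k ⧸ J) (List.ofFn y) := by
    let alg : Algebra (MvPolynomial (Fin n) k) (MvPolynomial (Fin (n + 1)) k ⧸ J) :=
      (((Ideal.Quotient.mk J).comp (ψ.symm : _ →+* MvPolynomial (Fin (n + 1)) k)).comp
        Polynomial.C).toAlgebra
    let E : (Polynomial (MvPolynomial (Fin n) k) ⧸ Ideal.span {F}) ≃+*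
        (MvPolynomial (Fin (n + 1)) k ⧸ J) :=
      Ideal.quotientEquiv _ _ ψ.symm.toRingEquiv (by
        rw [hJ, Ideal.map_span]; simp)
    let L : (Polynomial (MvPolynomial (Fin n) k) ⧸ Ideal.span {F}) ≃ₗ[MvPolynomial (Fin n) k]
        (MvPolynomial (Fin (n + 1)) k ⧸ J) :=
      { E with
        map_smul' := by
          intro r x
          obtain ⟨p, rfl⟩ := Ideal.Quotient.mk_surjective x
          change E (r • Ideal.Quotient.mk _ p) = r • E (Ideal.Quotient.mk _ p)
          have hrp : r • Ideal.Quotient.mk (Ideal.span {F}) p =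
              Ideal.Quotient.mk (Ideal.span {F}) (Polynomial.C r) * Ideal.Quotient.mk _ p := by
            rw [← map_mul, ← Polynomial.smul_eq_C_mul]; rfl
          rw [hrp, Algebra.smul_def, map_mul]
          rfl }
    have hfree : Module.Free (MvPolynomial (Fin n) k) (MvPolynomial (Fin (n + 1)) k ⧸ J) := by
      have := hF.free_quotient
      exact Module.Free.of_equiv L
    have hnt : Nontrivial (MvPolynomial (Fin (n + 1)) k ⧸ J) := by
      have : Nontrivial (Polynomial (MvPolynomial (Fin n) k) ⧸ Ideal.span {F}) := by
        rw [Ideal.Quotient.nontrivial_iff, Ne, Ideal.span_singleton_eq_top]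
        intro hu
        have := hF.eq_one_of_isUnit hu
        rw [this] at hFe
        simp at hFe
        omega
      exact E.symm.toEquiv.nontrivial
    have := (aux_regular (k := k) (auxDeg n) hpos).of_faithfullyFlat
      (S := MvPolynomial (Fin (n + 1)) k ⧸ J)
    rw [List.map_ofFn] at this
    exact this
  refine ⟨le_antisymm ?_ ?_, auxDeg n, y, hpos, ?_, hreg, e, ?_, ?_⟩
  · have h1 := ringKrullDim_quotient_succ_le_of_nonZeroDivisor (r := ψ.symm F)
      (mem_nonZeroDivisors_of_ne_zero (by simpa using hF.ne_zero))
    rw [← hJ, MvPolynomial.ringKrullDim_of_isNoetherianRing, ringKrullDim_eq_zero_of_field] at h1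
    simp only [Nat.card_eq_fintype_card, Fintype.card_fin, zero_add, Nat.cast_add, Nat.cast_one] at h1
    exact (ENat.WithBot.add_le_add_one_right_iff).mp h1
  · simpa using aux_dim_lower _ hreg
  · intro i
    rw [h𝒜]
    refine ⟨ψ.symm (Polynomial.C (X i ^ auxDeg n i)), ?_, rfl⟩
    rw [SetLike.mem_coe, mem_homogeneousSubmodule, map_pow, map_pow]
    simpa using (hψC i).pow (auxDeg n i)
  · rw [auxDeg_sum n hn]; omega
  · have hfin : Module.Finite k (homogeneousSubmodule (Fin (n + 1)) k e) :=
      Module.Finite.iff_fg.mpr (homogeneousSubmodule_fg _ _ _)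
    have hfin1 : Module.Finite k (𝒜 e) := by
      rw [h𝒜]; infer_instance
    let a : Fin n := ⟨0, by omega⟩
    let b : Fin n := ⟨1, by omega⟩
    let g : Fin 3 → Polynomial (MvPolynomial (Fin n) k) :=
      ![Polynomial.C (X a) * Polynomial.X ^ (e - 1), Polynomial.C (X b) * Polynomial.X ^ (e - 1),
        Polynomial.C (X a * X b) * Polynomial.X ^ (e - 2)]
    have hg : ∀ j, (ψ.symm (g j)).IsHomogeneous e := by
      have hX : ∀ l, (ψ.symm (Polynomial.X ^ l)).IsHomogeneous l := by
        intro l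
        rw [map_pow]; simpa using hψX.pow l
      intro j
      fin_cases j
      · have := (hψC a).mul (hX (e - 1))
        rw [← map_mul, show 1 + (e - 1) = e by omega] at this
        exact this
      · have := (hψC b).mul (hX (e - 1))
        rw [← map_mul, show 1 + (e - 1) = e by omega] at this
        exact this
      · have := ((hψC a).mul (hψC b)).mul (hX (e - 2))
        rw [← map_mul, ← map_mul, ← map_mul, show 1 + 1 + (e - 2) = e by omega] at this
        exact this
    let w : Fin 3 → ((𝒜 e).map (Ideal.Quotient.mkₐ k (Ideal.span (Set.range y))).toLinearMap) :=
      fun j => ⟨Ideal.Quotient.mk _ (Ideal.Quotient.mk J (ψ.symm (g j))),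
        ⟨Ideal.Quotient.mk J (ψ.symm (g j)), by
          rw [h𝒜]; exact ⟨_, hg j, rfl⟩, rfl⟩⟩
    have hw : LinearIndependent k w := by
      apply LinearIndependent.of_comp (Submodule.subtype _)
      rw [Fintype.linearIndependent_iff]
      intro c hc
      have h1 : Ideal.Quotient.mkₐ k (Ideal.span (Set.range y)) (Ideal.Quotient.mkₐ k J
          (ψ.symm (∑ j, c j • g j))) = 0 := by
        rw [← hc]
        simp only [map_sum, map_smul]
        rfl
      have h2 : Ideal.Quotient.mk J (ψ.symm (∑ j, c j • g j)) ∈ Ideal.span (Set.range y) :=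
        Ideal.Quotient.eq_zero_iff_mem.mp h1
      set I := Ideal.span (Set.range fun i => (X i : MvPolynomial (Fin n) k) ^ auxDeg n i) with hI
      have h4 := aux_dvd ψ.toRingEquiv F J hJ I (fun i => X i ^ auxDeg n i)
        (fun i => Ideal.subset_span ⟨i, rfl⟩) _ h2
      have hsum : ∑ j, c j • g j =
        Polynomial.C (C (c 0) * X a + C (c 1) * X b) * Polynomial.X ^ (e - 1)
        + Polynomial.C (C (c 2) * (X a * X b)) * Polynomial.X ^ (e - 2) := by
        have hs : ∀ (r : k) (p : Polynomial (MvPolynomial (Fin n) k)),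
            r • p = Polynomial.C (C r) * p := by
          intro r p
          rw [Algebra.smul_def]; rfl
        simp only [Fin.sum_univ_three, hs, g, Matrix.cons_val, map_add, map_mul]
        ring
      rw [hsum] at h4
      have := aux_indep hn he F hF hFe c a b rfl rfl h4
      intro i
      rw [this]; rfl
    simpa using hw.fintype_card_le_finrank

open MvPolynomial in
/-- shear -/
noncomputable def auxShear {k : Type*} [Field k] {n : ℕ} (c : Fin (n + 1) → k) (hc : c 0 = 0) :
    MvPolynomial (Fin (n + 1)) k ≃ₐ[k] MvPolynomial (Fin (n + 1)) k :=
  AlgEquiv.ofAlgHom (aeval fun i => X i + C (c i) * X 0) (aeval fun i => X i - C (c i) * X 0)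
    (by ext i : 1; simp [hc, algHom_C]) (by ext i : 1; simp [hc, algHom_C])

open MvPolynomial in
theorem aux_monic {k : Type*} [Field k] {n e : ℕ} (g : MvPolynomial (Fin (n + 1)) k)
    (hg : g.IsHomogeneous e) (h1 : eval (fun i => if i = 0 then 1 else 0) g ≠ 0) :
    ∃ (u : k) (F : Polynomial (MvPolynomial (Fin n) k)), u ≠ 0 ∧ F.Monic ∧ F.natDegree = e ∧
      (finSuccEquiv k n).symm F = C u * g := by
  set p := finSuccEquiv k n g with hp
  have hdeg : p.natDegree ≤ e := by
    rw [hp, natDegree_finSuccEquiv]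
    exact (degreeOf_le_totalDegree _ _).trans hg.totalDegree_le
  have hco : (p.coeff e).IsHomogeneous 0 := hg.finSuccEquiv_coeff_isHomogeneous e 0 rfl
  rw [← totalDegree_zero_iff_isHomogeneous, totalDegree_eq_zero_iff_eq_C] at hco
  set v := coeff 0 (p.coeff e) with hv
  have hv0 : v ≠ 0 := by
    intro hv0
    apply h1
    rw [eval_eq]
    apply Finset.sum_eq_zero
    intro d hd
    rw [hv, hp, finSuccEquiv_coeff_coeff] at hv0
    by_cases hd0 : ∃ i, i ≠ 0 ∧ d i ≠ 0
    · obtain ⟨i, hi, hdi⟩ := hd0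
      rw [Finset.prod_eq_zero (i := i) (by simpa using hdi) (by simp [hi, hdi]), mul_zero]
    · push Not at hd0
      have hdd := hg (mem_support_iff.mp hd)
      have : d = Finsupp.cons e 0 := by
        have h2 : d = Finsupp.single 0 (d 0) := by
          ext i
          by_cases hi : i = 0
          · subst hi; simp
          · simp [hd0 i hi, Finsupp.single_apply, Ne.symm hi]
        rw [h2, Finsupp.weight_single] at hdd
        simp at hdd
        ext i
        refine Fin.cases ?_ (fun j => ?_) i
        · simp [hdd]
        · simp [hd0 _ (Fin.succ_ne_zero j)]
      rw [this, hv0, zero_mul]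
  have hpe : p.coeff e ≠ 0 := by rw [hco]; simpa using hv0
  have hne : p.natDegree = e := le_antisymm hdeg (Polynomial.le_natDegree_of_ne_zero hpe)
  have hcoef : (Polynomial.C (C v⁻¹) * p).coeff e = 1 := by
    rw [Polynomial.coeff_C_mul, hco, ← C_mul, inv_mul_cancel₀ hv0, C_1]
  refine ⟨v⁻¹, Polynomial.C (C v⁻¹) * p, inv_ne_zero hv0, ?_, ?_, ?_⟩
  · exact Polynomial.monic_of_natDegree_le_of_coeff_eq_one e
      ((Polynomial.natDegree_C_mul_le _ _).trans hdeg) hcoef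
  · refine le_antisymm ((Polynomial.natDegree_C_mul_le _ _).trans hdeg)
      (Polynomial.le_natDegree_of_ne_zero ?_)
    rw [hcoef]; exact one_ne_zero
  · rw [map_mul, hp, AlgEquiv.symm_apply_apply]
    congr 1
    rw [AlgEquiv.symm_apply_eq]
    simp [finSuccEquiv_apply]



/-- Let `R = k[x₀,…,x_n]/(f)` where `n ≥ 2` and `f` is a nonzero
homogeneous polynomial of degree `e ≥ 4` (so `R` is a standard graded Cohen–Macaulay
algebra of Krull dimension `n`).  Then there is an `R`-regular sequence `y₁,…,y_n` of
homogeneous elements of positive degrees, with `m = ∑ deg yᵢ`, and an integer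
`c > m − n + 1` such that `dim_k (R/(y₁,…,y_n))_c ≥ 3`. -/
theorem stmt_13
    (k : Type) [Field k] [Infinite k]
    (n e : ℕ) (hn : 2 ≤ n) (he : 4 ≤ e)
    (f : MvPolynomial (Fin (n + 1)) k) (hf : f ≠ 0) (hfhom : f.IsHomogeneous e) :
    ∀ (J : Ideal (MvPolynomial (Fin (n + 1)) k)), J = Ideal.span {f} →
    ∀ (𝒜 : ℕ → Submodule k (MvPolynomial (Fin (n + 1)) k ⧸ J)),
      (∀ i, 𝒜 i = (MvPolynomial.homogeneousSubmodule (Fin (n + 1)) k i).map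
          (Ideal.Quotient.mkₐ k J).toLinearMap) →
    -- `R` is Cohen–Macaulay of Krull dimension `n`
    (ringKrullDim (MvPolynomial (Fin (n + 1)) k ⧸ J) = n) ∧
    -- an `R`-regular sequence of homogeneous elements with the required degree bound
    (∃ (mdeg : Fin n → ℕ) (y : Fin n → MvPolynomial (Fin (n + 1)) k ⧸ J),
      (∀ i, 0 < mdeg i) ∧ (∀ i, y i ∈ 𝒜 (mdeg i)) ∧
      RingTheory.Sequence.IsRegular (MvPolynomial (Fin (n + 1)) k ⧸ J) (List.ofFn y) ∧
      (∃ c : ℕ, (∑ i, mdeg i) - n + 1 < c ∧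
        3 ≤ Module.finrank k
          ((𝒜 c).map (Ideal.Quotient.mkₐ k
            (Ideal.span (Set.range y))).toLinearMap))) := by
  intro J hJ 𝒜 h𝒜
  open MvPolynomial in
  obtain ⟨q, hq⟩ : ∃ q, eval q (f * X 0) ≠ 0 := by
    by_contra! hq
    have : f * X 0 = 0 := MvPolynomial.funext (by simpa using hq)
    exact mul_ne_zero hf (X_ne_zero 0) this
  open MvPolynomial in
  rw [map_mul, eval_X] at hq
  have hq1 := left_ne_zero_of_mul hq
  have hq0 := right_ne_zero_of_mul hq
  let c : Fin (n + 1) → k := fun i => if i = 0 then 0 else q i / q 0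
  have hc : c 0 = 0 := by simp [c]
  let φ := auxShear c hc
  have hφ : ∀ p, φ p = MvPolynomial.aeval (fun i => MvPolynomial.X i + MvPolynomial.C (c i) * MvPolynomial.X 0) p := fun _ => rfl
  have hφs : ∀ p, φ.symm p = MvPolynomial.aeval (fun i => MvPolynomial.X i - MvPolynomial.C (c i) * MvPolynomial.X 0) p := fun _ => rfl
  have hsX : ∀ i, (φ.symm (MvPolynomial.X i)).IsHomogeneous 1 := by
    intro i
    rw [hφs, MvPolynomial.aeval_X]
    exact (MvPolynomial.isHomogeneous_X _ _).sub (MvPolynomial.isHomogeneous_C_mul_X _ _)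
  have hhom : (φ f).IsHomogeneous e := by
    rw [hφ]
    simpa using hfhom.aeval (fun i => MvPolynomial.X i + MvPolynomial.C (c i) * MvPolynomial.X 0)
      (fun i => (MvPolynomial.isHomogeneous_X _ _).add (MvPolynomial.isHomogeneous_C_mul_X (c i) 0))
  have hev : MvPolynomial.eval (fun i => if i = 0 then 1 else 0) (φ f) ≠ 0 := by
    have h1 : MvPolynomial.eval (fun i => if i = 0 then (1 : k) else 0) (φ f) =
        MvPolynomial.eval (fun i => (q 0)⁻¹ * q i) f := by
      rw [hφ, MvPolynomial.aeval_def, MvPolynomial.eval₂_eq', map_sum, MvPolynomial.eval_eq']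
      refine Finset.sum_congr rfl fun d _ => ?_
      rw [map_mul, map_prod]
      simp only [MvPolynomial.algebraMap_eq, MvPolynomial.eval_C, map_pow]
      congr 1
      refine Finset.prod_congr rfl fun i _ => ?_
      congr 1
      by_cases hi : i = 0
      · subst hi; simp [c, hq0]
      · simp [c, hi]; field_simp
    rw [h1]
    have h2 : MvPolynomial.eval (fun i => (q 0)⁻¹ * q i) f = (q 0)⁻¹ ^ e * MvPolynomial.eval q f := by
      rw [MvPolynomial.eval_eq, MvPolynomial.eval_eq, Finset.mul_sum]
      refine Finset.sum_congr rfl fun d hd => ?_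
      have hdd : d.degree = e := (hfhom.degree_eq_sum_deg_support hd).symm
      simp only [mul_pow, Finset.prod_mul_distrib, Finset.prod_pow_eq_pow_sum]
      rw [show ∑ i ∈ d.support, d i = e from hdd]
      ring
    rw [h2]
    exact mul_ne_zero (pow_ne_zero _ (inv_ne_zero hq0)) hq1
  obtain ⟨u, F, hu, hF, hFe, hFg⟩ := aux_monic (φ f) hhom hev
  have hψ : ∀ p, (φ.trans (MvPolynomial.finSuccEquiv k n)).symm p =
    φ.symm ((MvPolynomial.finSuccEquiv k n).symm p) := fun _ => rfl
  refine aux_core k n e hn he (φ.trans (MvPolynomial.finSuccEquiv k n)) ?_ ?_ F hF hFe J ?_ 𝒜 h𝒜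
  · rw [hψ, ← MvPolynomial.finSuccEquiv_X_zero, AlgEquiv.symm_apply_apply]
    exact hsX 0
  · intro i
    rw [hψ, ← MvPolynomial.finSuccEquiv_X_succ, AlgEquiv.symm_apply_apply]
    exact hsX _
  · rw [hψ, hFg, map_mul, AlgEquiv.symm_apply_apply, hJ]
    have h3 : φ.symm (MvPolynomial.C u) = MvPolynomial.C u := by
      rw [hφs, MvPolynomial.aeval_C]; rfl
    rw [h3, mul_comm]
    exact (Ideal.span_singleton_mul_right_unit ((isUnit_iff_ne_zero.mpr hu).map MvPolynomial.C) f).symm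
end
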